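/- arXiv:2305.12368 — 4 statements merged into one kernel-verified Lean document; each statement's English description precedes it below -/
import Mathlib

section
/- For every η ∈ (0,1), setting x := (η+1)/(η−1) ∈ (−∞,−1), the boundary value of Im g from the upper half-plane satisfies lim_{ε→0+} Im g(x + iε) = √3 · (3·Γ(2/3)/Γ(1/3)²) · η^{1/3} · ₂F₁(1/3, 2/3; 4/3; η). (This states that the right-hand sides of Cardy's formula and of the main theorem agree.) -/
open Complex Set Filter

/-- The Gauss hypergeometric function `₂F₁(p,q;r;z)` defined via the Euler integral
(principal branches of all complex powers). -/
noncomputable def hyp (p q r z : ℂ) : ℂ :=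
  Complex.Gamma r / (Complex.Gamma q * Complex.Gamma (r - q)) *
    ∫ t in (0:ℝ)..1, (t : ℂ) ^ (q - 1) * (1 - (t : ℂ)) ^ (r - q - 1) * (1 - (t : ℂ) * z) ^ (-p)

/-- The two slits `(-∞,-1] ∪ [1,+∞)` on the real axis, viewed inside `ℂ`. -/
def slit : Set ℂ := {z | z.im = 0 ∧ (z.re ≤ -1 ∨ 1 ≤ z.re)}

/-- The slit plane `D = ℂ ∖ ((-∞,-1] ∪ [1,+∞))`. -/
def Dslit : Set ℂ := slitᶜ

/-- `g(z) = (2√3·Γ(2/3)/(√π·Γ(1/6)))·z·₂F₁(1/2,2/3;3/2;z²)`. -/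
noncomputable def g (z : ℂ) : ℂ :=
  2 * (Real.sqrt 3 : ℂ) * Complex.Gamma (2/3) /
      ((Real.sqrt Real.pi : ℂ) * Complex.Gamma (1/6)) *
    z * hyp (1/2) (2/3) (3/2) (z ^ 2)

open MeasureTheory ProbabilityTheory Topology

/-- The Euler beta integral as a lower Lebesgue integral. -/
lemma lintegral_rpow_mul_one_sub_rpow {a c : ℝ} (ha : 0 < a) (hc : 0 < c) :
    ∫⁻ t in Ioo (0 : ℝ) 1, ENNReal.ofReal (t ^ (a - 1) * (1 - t) ^ (c - 1)) =
      ENNReal.ofReal (beta a c) := by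
  have hb := beta_pos ha hc
  have h := lintegral_betaPDF_eq_one ha hc
  rw [lintegral_betaPDF] at h
  have h2 : ∫⁻ t in Ioo (0 : ℝ) 1, ENNReal.ofReal (t ^ (a - 1) * (1 - t) ^ (c - 1)) =
      ENNReal.ofReal (beta a c) *
        ∫⁻ t in Ioo (0 : ℝ) 1, ENNReal.ofReal (1 / beta a c * t ^ (a - 1) * (1 - t) ^ (c - 1)) := by
    rw [← lintegral_const_mul' _ _ ENNReal.ofReal_ne_top]
    refine lintegral_congr fun t => ?_
    rw [← ENNReal.ofReal_mul hb.le]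
    congr 1
    field_simp
  rw [h2, h, mul_one]

lemma image_mobius_Ioo {z : ℝ} (hz0 : 0 ≤ z) (hz1 : z < 1) :
    (fun t : ℝ => t * (1 - z) / (1 - t * z)) '' Ioo 0 1 = Ioo 0 1 := by
  ext u
  constructor
  · rintro ⟨t, ⟨h0, h1⟩, rfl⟩
    have hC : 0 < 1 - t * z := by nlinarith
    refine ⟨by have : 0 < 1 - z := by linarith
               positivity, ?_⟩
    show t * (1 - z) / (1 - t * z) < 1
    rw [div_lt_one hC]
    linarith
  · rintro ⟨h0, h1⟩
    have hE : 0 < 1 - z + u * z := by nlinarith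
    refine ⟨u / (1 - z + u * z), ⟨by positivity, ?_⟩, ?_⟩
    · rw [div_lt_one hE]; nlinarith
    · have h3 : 1 - u / (1 - z + u * z) * z = (1 - z) / (1 - z + u * z) := by
        field_simp; ring
      have h4 : 1 - z ≠ 0 := by linarith
      show u / (1 - z + u * z) * (1 - z) / (1 - u / (1 - z + u * z) * z) = u
      rw [h3]; field_simp

/-- The hypergeometric integral is elementary when the third exponent is balanced. -/
lemma lintegral_rpow_balanced {a c z : ℝ} (ha : 0 < a) (hc : 0 < c) (hz0 : 0 ≤ z) (hz1 : z < 1) :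
    ∫⁻ t in Ioo (0 : ℝ) 1,
        ENNReal.ofReal (t ^ (a - 1) * (1 - t) ^ (c - 1) * (1 - t * z) ^ (-(a + c))) =
      ENNReal.ofReal (beta a c * (1 - z) ^ (-a)) := by
  have hD : 0 < 1 - z := by linarith
  have hC : ∀ t ∈ Ioo (0 : ℝ) 1, 0 < 1 - t * z := fun t ht => by nlinarith [ht.1, ht.2]
  have hderiv : ∀ t ∈ Ioo (0 : ℝ) 1, HasDerivWithinAt (fun t : ℝ => t * (1 - z) / (1 - t * z))
      ((1 - z) / (1 - t * z) ^ 2) (Ioo 0 1) t := by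
    intro t ht
    have := ((hasDerivAt_id t).mul_const (1 - z)).div
      (((hasDerivAt_id t).mul_const z).const_sub 1) (hC t ht).ne'
    refine (this.congr_deriv ?_).hasDerivWithinAt
    simp only [id]; ring
  have hinj : InjOn (fun t : ℝ => t * (1 - z) / (1 - t * z)) (Ioo 0 1) := by
    intro s hs t ht h
    have h1 := hC s hs
    have h2 := hC t ht
    simp only at h
    rw [div_eq_div_iff h1.ne' h2.ne'] at h
    have : (1 - z) * (s - t) = 0 := by linarith
    rcases mul_eq_zero.1 this with h | h <;> linarith
  have key := lintegral_image_eq_lintegral_abs_deriv_mul measurableSet_Ioo hderiv hinj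
    (fun u => ENNReal.ofReal (u ^ (a - 1) * (1 - u) ^ (c - 1)))
  rw [image_mobius_Ioo hz0 hz1, lintegral_rpow_mul_one_sub_rpow ha hc] at key
  have h2 : ∀ t ∈ Ioo (0 : ℝ) 1,
      ENNReal.ofReal (t ^ (a - 1) * (1 - t) ^ (c - 1) * (1 - t * z) ^ (-(a + c))) =
      ENNReal.ofReal ((1 - z) ^ (-a)) * (ENNReal.ofReal |(1 - z) / (1 - t * z) ^ 2| *
      ENNReal.ofReal ((t * (1 - z) / (1 - t * z)) ^ (a - 1) *
        (1 - t * (1 - z) / (1 - t * z)) ^ (c - 1))) := by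
    intro t ht
    have h1 := hC t ht
    have hB : 0 < 1 - t := by linarith [ht.2]
    have hA := ht.1
    rw [← ENNReal.ofReal_mul (abs_nonneg _), ← ENNReal.ofReal_mul (by positivity),
      abs_of_pos (by positivity)]
    congr 1
    have e : 1 - t * (1 - z) / (1 - t * z) = (1 - t) / (1 - t * z) := by field_simp; ring
    have e2 : (1 - z) / (1 - t * z) ^ 2 =
        Real.exp (Real.log (1 - z) - 2 * Real.log (1 - t * z)) := by
      rw [Real.exp_sub, Real.exp_log hD, mul_comm 2, Real.exp_mul, Real.exp_log h1]
      norm_cast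
    rw [e, e2, Real.rpow_def_of_pos hA, Real.rpow_def_of_pos hB, Real.rpow_def_of_pos h1,
      Real.rpow_def_of_pos hD, Real.rpow_def_of_pos (by positivity),
      Real.rpow_def_of_pos (by positivity), Real.log_div (by positivity) h1.ne',
      Real.log_mul hA.ne' hD.ne', Real.log_div hB.ne' h1.ne']
    simp only [← Real.exp_add]
    congr 1
    ring
  rw [setLIntegral_congr_fun measurableSet_Ioo h2,
    lintegral_const_mul' _ _ ENNReal.ofReal_ne_top, ← key,
    ← ENNReal.ofReal_mul (by positivity), mul_comm]

lemma lintegral_rpow_mul_one_sub_mul_rpow {b t z : ℝ} (hb : 0 < b) (ht0 : 0 < t) (ht1 : t < 1)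
    (hz0 : 0 < z) (hz1 : z < 1) :
    ∫⁻ s in Ioo (0 : ℝ) z, ENNReal.ofReal (b * s ^ (b - 1) * (1 - t * s) ^ (-(b + 1))) =
      ENNReal.ofReal (z ^ b * (1 - t * z) ^ (-b)) := by
  have hpos : ∀ s ∈ Icc 0 z, 0 < 1 - t * s := fun s hs => by nlinarith [hs.1, hs.2]
  have hcont : ContinuousOn (fun s : ℝ => s ^ b * (1 - t * s) ^ (-b)) (Icc 0 z) := by
    refine ContinuousOn.mul (fun s hs => ?_) (fun s hs => ?_)
    · exact (Real.continuousAt_rpow_const _ _ (Or.inr hb.le)).continuousWithinAt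
    · exact (ContinuousAt.rpow_const (f := fun s : ℝ => 1 - t * s) (by fun_prop)
        (Or.inl (hpos s hs).ne')).continuousWithinAt
  have hderiv : ∀ s ∈ Ioo 0 z, HasDerivAt (fun s : ℝ => s ^ b * (1 - t * s) ^ (-b))
      (b * s ^ (b - 1) * (1 - t * s) ^ (-(b + 1))) s := by
    intro s hs
    have h1 := hpos s ⟨hs.1.le, hs.2.le⟩
    have h2 := (Real.hasDerivAt_rpow_const (p := b) (Or.inl hs.1.ne')).mul
      ((((hasDerivAt_id s).const_mul t).const_sub 1).rpow_const (p := -b) (Or.inl h1.ne'))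
    refine h2.congr_deriv ?_
    simp only [id]
    have e1 : (1 - t * s) ^ (-b) = (1 - t * s) ^ (-(b + 1)) * (1 - t * s) := by
      rw [← Real.rpow_add_one h1.ne']; congr 1; ring
    have e2 : s ^ b = s ^ (b - 1) * s := by
      rw [← Real.rpow_add_one hs.1.ne']; congr 1; ring
    have e3 : -b - 1 = -(b + 1) := by ring
    rw [e1, e2, e3]; ring
  have hnn : ∀ s ∈ Ioo 0 z, 0 ≤ b * s ^ (b - 1) * (1 - t * s) ^ (-(b + 1)) := fun s hs => by
    have h1 := hpos s ⟨hs.1.le, hs.2.le⟩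
    have := hs.1
    positivity
  have hint := intervalIntegral.integrableOn_deriv_of_nonneg hcont hderiv hnn
  have hftc := intervalIntegral.integral_eq_sub_of_hasDerivAt_of_le hz0.le hcont hderiv
    ((intervalIntegrable_iff_integrableOn_Ioc_of_le hz0.le).2 hint)
  rw [intervalIntegral.integral_of_le hz0.le, integral_Ioc_eq_integral_Ioo,
    Real.zero_rpow hb.ne', zero_mul, sub_zero] at hftc
  rw [← hftc, ofReal_integral_eq_lintegral_ofReal (hint.mono_set Ioo_subset_Ioc_self)
    (ae_restrict_of_forall_mem measurableSet_Ioo hnn)]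

lemma lintegral_euler_eq {a b z : ℝ} (ha : 0 < a) (hb : 0 < b) (hab : a < b + 1)
    (hz0 : 0 < z) (hz1 : z < 1) :
    ENNReal.ofReal (z ^ b) * ∫⁻ t in Ioo (0 : ℝ) 1,
        ENNReal.ofReal (t ^ (a - 1) * (1 - t) ^ (b - a) * (1 - t * z) ^ (-b)) =
      ENNReal.ofReal (b * beta a (b + 1 - a)) *
        ∫⁻ s in Ioo (0 : ℝ) z, ENNReal.ofReal (s ^ (b - 1) * (1 - s) ^ (-a)) := by
  have hβ := beta_pos ha (by linarith : 0 < b + 1 - a)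
  rw [← lintegral_const_mul' _ _ ENNReal.ofReal_ne_top,
    ← lintegral_const_mul' _ _ ENNReal.ofReal_ne_top]
  have h1 : ∀ t ∈ Ioo (0 : ℝ) 1, ENNReal.ofReal (z ^ b) *
      ENNReal.ofReal (t ^ (a - 1) * (1 - t) ^ (b - a) * (1 - t * z) ^ (-b)) =
      ∫⁻ s in Ioo (0 : ℝ) z, ENNReal.ofReal (t ^ (a - 1) * (1 - t) ^ (b - a) *
        (b * s ^ (b - 1) * (1 - t * s) ^ (-(b + 1)))) := by
    intro t ht
    have hA := ht.1
    have hB : 0 < 1 - t := by linarith [ht.2]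
    rw [← ENNReal.ofReal_mul (by positivity)]
    simp_rw [ENNReal.ofReal_mul (show 0 ≤ t ^ (a - 1) * (1 - t) ^ (b - a) by positivity)]
    rw [lintegral_const_mul' _ _ ENNReal.ofReal_ne_top,
      lintegral_rpow_mul_one_sub_mul_rpow hb ht.1 ht.2 hz0 hz1, ← ENNReal.ofReal_mul (by positivity)]
    congr 1; ring
  rw [setLIntegral_congr_fun measurableSet_Ioo h1, lintegral_lintegral_swap
    (Measurable.aemeasurable (by simp only [Function.uncurry_def]; fun_prop))]
  refine setLIntegral_congr_fun measurableSet_Ioo fun s hs => ?_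
  have hs0 := hs.1
  have hs1 : 0 < 1 - s := by linarith [hs.2]
  have h2 : ∀ t : ℝ, ENNReal.ofReal (t ^ (a - 1) * (1 - t) ^ (b - a) *
        (b * s ^ (b - 1) * (1 - t * s) ^ (-(b + 1)))) = ENNReal.ofReal (b * s ^ (b - 1)) *
        ENNReal.ofReal (t ^ (a - 1) * (1 - t) ^ ((b + 1 - a) - 1) *
          (1 - t * s) ^ (-(a + (b + 1 - a)))) := by
    intro t
    rw [← ENNReal.ofReal_mul (by positivity)]
    congr 1
    rw [show (b + 1 - a) - 1 = b - a by ring, show a + (b + 1 - a) = b + 1 by ring]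
    ring
  simp_rw [h2]
  rw [lintegral_const_mul' _ _ ENNReal.ofReal_ne_top,
    lintegral_rpow_balanced ha (by linarith) hs0.le (by linarith),
    ← ENNReal.ofReal_mul (by positivity), ← ENNReal.ofReal_mul (by positivity)]
  congr 1; ring

/-- Interchanging the first two parameters of the Euler integral when the third one exceeds
`b` by one. -/
lemma integral_euler_eq {a b z : ℝ} (ha : 0 < a) (hb : 0 < b) (hab : a < b + 1)
    (hz0 : 0 < z) (hz1 : z < 1) :
    z ^ b * ∫ t in Ioo (0 : ℝ) 1, t ^ (a - 1) * (1 - t) ^ (b - a) * (1 - t * z) ^ (-b) =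
      b * beta a (b + 1 - a) * ∫ s in Ioo (0 : ℝ) z, s ^ (b - 1) * (1 - s) ^ (-a) := by
  have hβ := beta_pos ha (by linarith : 0 < b + 1 - a)
  rw [integral_eq_lintegral_of_nonneg_ae, integral_eq_lintegral_of_nonneg_ae]
  · have := congrArg ENNReal.toReal (lintegral_euler_eq ha hb hab hz0 hz1)
    rwa [ENNReal.toReal_mul, ENNReal.toReal_mul, ENNReal.toReal_ofReal (by positivity),
      ENNReal.toReal_ofReal (by positivity)] at this
  · refine ae_restrict_of_forall_mem measurableSet_Ioo fun s hs => ?_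
    have h0 := hs.1
    have h1 : 0 < 1 - s := by linarith [hs.2]
    simp only [Pi.zero_apply]
    positivity
  · exact Measurable.aestronglyMeasurable (by fun_prop)
  · refine ae_restrict_of_forall_mem measurableSet_Ioo fun s hs => ?_
    have h0 := hs.1
    have h1 : 0 < 1 - s := by linarith [hs.2]
    have h2 : 0 < 1 - s * z := by nlinarith
    simp only [Pi.zero_apply]
    positivity
  · exact Measurable.aestronglyMeasurable (by fun_prop)

lemma one_sub_four_mul_div_sq {u : ℝ} (hu : 0 < u) :
    1 - 4 * u / (1 + u) ^ 2 = ((1 - u) / (1 + u)) ^ 2 := by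
  field_simp; ring

lemma strictMonoOn_four_mul_div_sq :
    StrictMonoOn (fun u : ℝ => 4 * u / (1 + u) ^ 2) (Icc 0 1) := by
  intro s hs t ht hst
  obtain ⟨hs0, hs1⟩ := hs
  obtain ⟨ht0, ht1⟩ := ht
  show 4 * s / (1 + s) ^ 2 < 4 * t / (1 + t) ^ 2
  rw [div_lt_div_iff₀ (by positivity) (by positivity)]
  have : 0 < (t - s) * (1 - s * t) := mul_pos (by linarith) (by nlinarith)
  nlinarith

lemma image_four_mul_div_sq_Ioo {η : ℝ} (h0 : 0 < η) (h1 : η < 1) :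
    (fun u : ℝ => 4 * u / (1 + u) ^ 2) '' Ioo 0 η = Ioo 0 (4 * η / (1 + η) ^ 2) := by
  apply Subset.antisymm
  · rintro _ ⟨u, ⟨hu0, hu1⟩, rfl⟩
    exact ⟨by positivity, strictMonoOn_four_mul_div_sq ⟨hu0.le, by linarith⟩ ⟨h0.le, h1.le⟩ hu1⟩
  · have hc : ContinuousOn (fun u : ℝ => 4 * u / (1 + u) ^ 2) (Icc 0 η) := by
      refine ContinuousOn.div (by fun_prop) (by fun_prop) fun u hu => ?_
      have := hu.1
      positivity
    simpa using intermediate_value_Ioo h0.le hc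

lemma integral_quadratic_substitution {η : ℝ} (h0 : 0 < η) (h1 : η < 1) :
    ∫ s in Ioo 0 (4 * η / (1 + η) ^ 2), s ^ ((1 / 3 : ℝ) - 1) * (1 - s) ^ (-(5 / 6 : ℝ)) =
      4 ^ (1 / 3 : ℝ) * ∫ u in Ioo 0 η, u ^ ((1 / 3 : ℝ) - 1) * (1 - u) ^ (-(2 / 3 : ℝ)) := by
  have hderiv : ∀ u ∈ Ioo (0 : ℝ) η, HasDerivWithinAt (fun u : ℝ => 4 * u / (1 + u) ^ 2)
      (4 * (1 - u) / (1 + u) ^ 3) (Ioo 0 η) u := by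
    intro u hu
    have hu0 := hu.1
    have hn : HasDerivAt (fun y : ℝ => 4 * y) 4 u := by
      simpa using (hasDerivAt_id u).const_mul 4
    have hd : HasDerivAt (fun y : ℝ => (1 + y) ^ 2) (2 * (1 + u)) u := by
      simpa using ((hasDerivAt_id u).const_add 1).fun_pow 2
    refine ((hn.fun_div hd (by positivity)).congr_deriv ?_).hasDerivWithinAt
    field_simp; ring
  have hinj : InjOn (fun u : ℝ => 4 * u / (1 + u) ^ 2) (Ioo 0 η) :=
    strictMonoOn_four_mul_div_sq.injOn.mono (Ioo_subset_Icc_self.trans (Icc_subset_Icc_right h1.le))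
  rw [← image_four_mul_div_sq_Ioo h0 h1,
    integral_image_eq_integral_abs_deriv_smul measurableSet_Ioo hderiv hinj,
    ← integral_const_mul]
  refine setIntegral_congr_fun measurableSet_Ioo fun u hu => ?_
  have hA := hu.1
  have hB : 0 < 1 - u := by linarith [hu.2]
  have hC : 0 < 1 + u := by linarith
  simp only [smul_eq_mul]
  rw [one_sub_four_mul_div_sq hA, abs_of_pos (by positivity)]
  have e : 4 * (1 - u) / (1 + u) ^ 3 =
      Real.exp (Real.log 4 + Real.log (1 - u) - 3 * Real.log (1 + u)) := by
    rw [Real.exp_sub, Real.exp_add, Real.exp_log hB, Real.exp_log (by norm_num), mul_comm 3,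
      Real.exp_mul, Real.exp_log hC]
    norm_cast
  rw [e, Real.rpow_def_of_pos hA, Real.rpow_def_of_pos hB,
    Real.rpow_def_of_pos (show (0 : ℝ) < 4 by norm_num),
    Real.rpow_def_of_pos (show 0 < 4 * u / (1 + u) ^ 2 by positivity),
    Real.rpow_def_of_pos (show 0 < ((1 - u) / (1 + u)) ^ 2 by positivity),
    Real.log_pow, Real.log_div (by positivity) (by positivity),
    Real.log_div hB.ne' hC.ne', Real.log_mul (by norm_num) hA.ne', Real.log_pow]
  simp only [← Real.exp_add]
  congr 1
  push_cast
  ring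

lemma image_one_sub_mul_Ioo {ζ : ℝ} (h0 : 0 < ζ) :
    (fun v : ℝ => 1 - ζ * v) '' Ioo 0 1 = Ioo (1 - ζ) 1 := by
  ext t
  constructor
  · rintro ⟨v, ⟨hv0, hv1⟩, rfl⟩
    constructor <;> simp only <;> nlinarith
  · rintro ⟨ht0, ht1⟩
    refine ⟨(1 - t) / ζ, ⟨div_pos (by linarith) h0, ?_⟩, ?_⟩
    · rw [div_lt_one h0]; linarith
    · field_simp; ring

lemma integral_tail_substitution {X : ℝ} (hX : 1 < X) :
    ∫ t in Ioo (1 / X) 1, t ^ (-(1 / 3) : ℝ) * (1 - t) ^ (-(1 / 6) : ℝ) *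
        (t * X - 1) ^ (-(1 / 2) : ℝ) =
      (1 - 1 / X) ^ (1 / 3 : ℝ) * X ^ (-(1 / 2) : ℝ) *
        ∫ v in Ioo (0 : ℝ) 1, v ^ ((5 / 6 : ℝ) - 1) * (1 - v) ^ ((1 / 3 : ℝ) - 5 / 6) *
          (1 - v * (1 - 1 / X)) ^ (-(1 / 3 : ℝ)) := by
  have hX0 : 0 < X := by linarith
  have hζ : 0 < 1 - 1 / X := by
    rw [sub_pos, div_lt_one hX0]; exact hX
  have hζ1 : 1 - 1 / X < 1 := by
    have : 0 < 1 / X := by positivity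
    linarith
  have hderiv : ∀ v ∈ Ioo (0 : ℝ) 1, HasDerivWithinAt (fun v : ℝ => 1 - (1 - 1 / X) * v)
      (-(1 - 1 / X)) (Ioo 0 1) v := fun v _ => by
    simpa using (((hasDerivAt_id v).const_mul (1 - 1 / X)).const_sub 1).hasDerivWithinAt
  have hinj : InjOn (fun v : ℝ => 1 - (1 - 1 / X) * v) (Ioo 0 1) := fun s _ t _ h => by
    have : (1 - 1 / X) * s = (1 - 1 / X) * t := by simp only at h; linarith
    exact mul_left_cancel₀ hζ.ne' this
  have him := image_one_sub_mul_Ioo hζ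
  rw [sub_sub_cancel] at him
  rw [← him, integral_image_eq_integral_abs_deriv_smul measurableSet_Ioo hderiv hinj,
    ← integral_const_mul]
  refine setIntegral_congr_fun measurableSet_Ioo fun v hv => ?_
  have hA := hv.1
  have hB : 0 < 1 - v := by linarith [hv.2]
  simp only [smul_eq_mul]
  have e1 : (1 - (1 - 1 / X) * v) * X - 1 = X * (1 - 1 / X) * (1 - v) := by field_simp; ring
  have e2 : 1 - (1 - (1 - 1 / X) * v) = (1 - 1 / X) * v := by ring
  have e3 : 1 - (1 - 1 / X) * v = 1 - v * (1 - 1 / X) := by ring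
  rw [e1, e2, e3, abs_neg, abs_of_pos hζ]
  set ζ := 1 - 1 / X
  have hC : 0 < 1 - v * ζ := by nlinarith
  have e : ζ * (((ζ * v) ^ (-(1 / 6) : ℝ)) * (X * ζ * (1 - v)) ^ (-(1 / 2) : ℝ)) =
      ζ ^ (1 / 3 : ℝ) * X ^ (-(1 / 2) : ℝ) *
        (v ^ ((5 / 6 : ℝ) - 1) * (1 - v) ^ ((1 / 3 : ℝ) - 5 / 6)) := by
    have e4 : ζ = Real.exp (Real.log ζ) := (Real.exp_log hζ).symm
    nth_rw 1 [e4]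
    rw [Real.rpow_def_of_pos hA, Real.rpow_def_of_pos hB, Real.rpow_def_of_pos hζ,
      Real.rpow_def_of_pos hX0, Real.rpow_def_of_pos (by positivity),
      Real.rpow_def_of_pos (by positivity), Real.log_mul (by positivity) hB.ne',
      Real.log_mul hX0.ne' hζ.ne', Real.log_mul hζ.ne' hA.ne']
    simp only [← Real.exp_add]
    congr 1
    ring
  linear_combination (1 - v * ζ) ^ (-(1 / 3) : ℝ) * e

/-- The quadratic transformation behind the equivalence of the two formulas. -/
lemma integral_tail_eq {η x : ℝ} (h0 : 0 < η) (h1 : η < 1) (hx : x = (η + 1) / (η - 1)) :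
    -x * ∫ t in Ioo (1 / x ^ 2) 1, t ^ (-(1 / 3) : ℝ) * (1 - t) ^ (-(1 / 6) : ℝ) *
        (t * x ^ 2 - 1) ^ (-(1 / 2) : ℝ) =
      1 / 3 * beta (5 / 6) (1 / 2) * 4 ^ (1 / 3 : ℝ) *
        ∫ u in Ioo 0 η, u ^ ((1 / 3 : ℝ) - 1) * (1 - u) ^ (-(2 / 3 : ℝ)) := by
  have hη : η - 1 < 0 := by linarith
  have hxneg : x < -1 := by
    rw [hx, div_lt_iff_of_neg hη]; linarith
  have hX : 1 < x ^ 2 := by nlinarith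
  have hζ : 1 - 1 / x ^ 2 = 4 * η / (1 + η) ^ 2 := by
    have : η - 1 ≠ 0 := hη.ne
    have h3 : η + 1 ≠ 0 := by linarith
    have h4 : 1 + η ≠ 0 := by linarith
    rw [hx]; field_simp; ring
  have hζ0 : 0 < 1 - 1 / x ^ 2 := by
    rw [hζ]; positivity
  have hζ1 : 1 - 1 / x ^ 2 < 1 := by
    have : 0 < 1 / x ^ 2 := by positivity
    linarith
  have h2 := integral_euler_eq (a := 5 / 6) (b := 1 / 3) (by norm_num) (by norm_num)
    (by norm_num) hζ0 hζ1
  rw [integral_tail_substitution hX]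
  have e : (x ^ 2) ^ (-(1 / 2) : ℝ) = (-x)⁻¹ := by
    rw [Real.rpow_neg (by positivity), ← Real.sqrt_eq_rpow, Real.sqrt_sq_eq_abs,
      abs_of_neg (by linarith)]
  have hx0 : -x ≠ 0 := by linarith
  rw [e]
  calc _ = -x * (-x)⁻¹ * ((1 - 1 / x ^ 2) ^ (1 / 3 : ℝ) *
        ∫ v in Ioo (0 : ℝ) 1, v ^ ((5 / 6 : ℝ) - 1) * (1 - v) ^ ((1 / 3 : ℝ) - 5 / 6) *
          (1 - v * (1 - 1 / x ^ 2)) ^ (-(1 / 3 : ℝ))) := by ring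
    _ = _ := by
      rw [mul_inv_cancel₀ hx0, one_mul, h2, hζ, integral_quadratic_substitution h0 h1]
      norm_num
      ring

lemma rpow_neg_mul_rpow_neg_le {a b p q : ℝ} (ha : 0 < a) (hb : 0 < b) (hp : 0 ≤ p) (hq : 0 ≤ q) :
    a ^ (-p) * b ^ (-q) ≤ a ^ (-(p + q)) + b ^ (-(p + q)) := by
  rw [neg_add, Real.rpow_add ha, Real.rpow_add hb]
  rcases le_total a b with h | h
  · have := Real.rpow_le_rpow_of_nonpos ha h (neg_nonpos.2 hq)
    have h2 : a ^ (-p) * b ^ (-q) ≤ a ^ (-p) * a ^ (-q) := by gcongr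
    have h3 : 0 ≤ b ^ (-p) * b ^ (-q) := by positivity
    linarith
  · have := Real.rpow_le_rpow_of_nonpos hb h (neg_nonpos.2 hp)
    have h2 : a ^ (-p) * b ^ (-q) ≤ b ^ (-p) * b ^ (-q) := by gcongr
    have h3 : 0 ≤ a ^ (-p) * a ^ (-q) := by positivity
    linarith

lemma half_rpow_neg_le_two {s p : ℝ} (hs : 1 / 2 ≤ s) (hp0 : 0 ≤ p) (hp : p ≤ 1) :
    s ^ (-p) ≤ 2 := by
  calc s ^ (-p) ≤ (1 / 2 : ℝ) ^ (-p) :=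
        Real.rpow_le_rpow_of_nonpos (by norm_num) hs (neg_nonpos.2 hp0)
    _ ≤ (1 / 2 : ℝ) ^ (-1 : ℝ) :=
        Real.rpow_le_rpow_of_exponent_ge (by norm_num) (by norm_num) (by linarith)
    _ = 2 := by rw [Real.rpow_neg_one]; norm_num

/-- An integrable majorant of the Euler integrand along the slit, with `v = |1 - t X|`. -/
lemma euler_kernel_le {t v : ℝ} (h0 : 0 < t) (h1 : t < 1) (hv : 0 < v) :
    t ^ (-(1 / 3) : ℝ) * (1 - t) ^ (-(1 / 6) : ℝ) * v ^ (-(1 / 2) : ℝ) ≤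
      2 * (t ^ (-(1 / 3 + 1 / 2) : ℝ) + v ^ (-(1 / 3 + 1 / 2) : ℝ)) +
      2 * ((1 - t) ^ (-(1 / 6 + 1 / 2) : ℝ) + v ^ (-(1 / 6 + 1 / 2) : ℝ)) := by
  have hs : 0 < 1 - t := by linarith
  have e1 := rpow_neg_mul_rpow_neg_le (p := 1 / 3) (q := 1 / 2) h0 hv (by norm_num) (by norm_num)
  have e2 := rpow_neg_mul_rpow_neg_le (p := 1 / 6) (q := 1 / 2) hs hv (by norm_num) (by norm_num)
  have p1 : 0 < t ^ (-(1 / 3) : ℝ) := by positivity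
  have p2 : 0 < (1 - t) ^ (-(1 / 6) : ℝ) := by positivity
  have p3 : 0 < v ^ (-(1 / 2) : ℝ) := by positivity
  rcases le_total (1 / 2) t with h | h
  · have := half_rpow_neg_le_two (p := 1 / 3) h (by norm_num) (by norm_num)
    have h3 : t ^ (-(1 / 3) : ℝ) * (1 - t) ^ (-(1 / 6) : ℝ) * v ^ (-(1 / 2) : ℝ) ≤
      2 * (1 - t) ^ (-(1 / 6) : ℝ) * v ^ (-(1 / 2) : ℝ) := by gcongr
    nlinarith [mul_pos p1 p3]
  · have := half_rpow_neg_le_two (s := 1 - t) (p := 1 / 6) (by linarith) (by norm_num)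
      (by norm_num)
    have h3 : t ^ (-(1 / 3) : ℝ) * (1 - t) ^ (-(1 / 6) : ℝ) * v ^ (-(1 / 2) : ℝ) ≤
      t ^ (-(1 / 3) : ℝ) * 2 * v ^ (-(1 / 2) : ℝ) := by gcongr
    nlinarith [mul_pos p2 p3]

lemma integrableOn_abs_rpow_affine {r X : ℝ} (hr : -1 < r) (hX : 0 < X) :
    IntegrableOn (fun t : ℝ => |1 - t * X| ^ r) (Ioo 0 1) := by
  have h : IntervalIntegrable (fun y : ℝ => |y| ^ r) volume (1 - 0) (1 - X) := by
    refine (intervalIntegral.intervalIntegrable_cpow' (r := (r : ℂ)) (by simpa)).norm.congr ?_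
    exact fun y _ => by simp [Complex.norm_cpow_real]
  have h2 := (h.comp_sub_left 1).comp_mul_right (c := X)
  simp only [sub_sub_cancel, zero_div, div_self hX.ne'] at h2
  exact ((intervalIntegrable_iff_integrableOn_Ioc_of_le zero_le_one).1 h2).mono_set
    Ioo_subset_Ioc_self

lemma integrableOn_euler_majorant {X : ℝ} (hX : 0 < X) :
    IntegrableOn (fun t : ℝ =>
      2 * (t ^ (-(1 / 3 + 1 / 2) : ℝ) + |1 - t * X| ^ (-(1 / 3 + 1 / 2) : ℝ)) +
      2 * ((1 - t) ^ (-(1 / 6 + 1 / 2) : ℝ) + |1 - t * X| ^ (-(1 / 6 + 1 / 2) : ℝ))) (Ioo 0 1) := by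
  have h1 : IntegrableOn (fun t : ℝ => t ^ (-(1 / 3 + 1 / 2) : ℝ)) (Ioo 0 1) :=
    ((intervalIntegrable_iff_integrableOn_Ioc_of_le zero_le_one).1
      (intervalIntegral.intervalIntegrable_rpow' (by norm_num))).mono_set Ioo_subset_Ioc_self
  have h2 : IntegrableOn (fun t : ℝ => (1 - t) ^ (-(1 / 6 + 1 / 2) : ℝ)) (Ioo 0 1) := by
    refine (integrableOn_abs_rpow_affine (r := -(1 / 6 + 1 / 2)) (by norm_num)
      one_pos).congr_fun (fun t ht => ?_) measurableSet_Ioo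
    simp only [mul_one]
    rw [abs_of_pos (by linarith [ht.2])]
  exact ((h1.add (integrableOn_abs_rpow_affine (by norm_num) hX)).const_mul 2).add
    ((h2.add (integrableOn_abs_rpow_affine (by norm_num) hX)).const_mul 2)

lemma norm_euler_integrand {t : ℝ} (h0 : 0 < t) (h1 : t < 1) (w : ℂ) :
    ‖(t : ℂ) ^ ((2 / 3 : ℂ) - 1) * (1 - (t : ℂ)) ^ ((3 / 2 : ℂ) - 2 / 3 - 1) *
        (1 - (t : ℂ) * w) ^ (-(1 / 2 : ℂ))‖ =
      t ^ (-(1 / 3) : ℝ) * (1 - t) ^ (-(1 / 6) : ℝ) * ‖1 - (t : ℂ) * w‖ ^ (-(1 / 2) : ℝ) := by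
  have e1 : (2 / 3 : ℂ) - 1 = ((-(1 / 3) : ℝ) : ℂ) := by push_cast; norm_num
  have e2 : (3 / 2 : ℂ) - 2 / 3 - 1 = ((-(1 / 6) : ℝ) : ℂ) := by push_cast; norm_num
  have e3 : (-(1 / 2 : ℂ)) = ((-(1 / 2) : ℝ) : ℂ) := by push_cast; norm_num
  have e4 : (1 - (t : ℂ)) = ((1 - t : ℝ) : ℂ) := by push_cast; rfl
  rw [e1, e2, e3, e4, norm_mul, norm_mul, norm_cpow_real, norm_cpow_real, norm_cpow_real,
    norm_real, norm_real, Real.norm_of_nonneg h0.le, Real.norm_of_nonneg (by linarith)]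

lemma abs_one_sub_mul_sq_le_norm {t x ε : ℝ} (ht : 0 ≤ t) :
    |1 - t * x ^ 2| ≤ ‖1 - (t : ℂ) * ((x : ℂ) + ε * I) ^ 2‖ := by
  have e : 1 - (t : ℂ) * ((x : ℂ) + ε * I) ^ 2 =
      ((1 - t * (x ^ 2 - ε ^ 2) : ℝ) : ℂ) + ((-(2 * t * x * ε) : ℝ) : ℂ) * I := by
    push_cast
    linear_combination (-(t : ℂ) * ε ^ 2) * I_sq
  rw [e, norm_add_mul_I]
  refine Real.abs_le_sqrt ?_
  have : 0 ≤ 2 * t * ε ^ 2 * (1 + t * x ^ 2) + t ^ 2 * ε ^ 4 := by positivity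
  nlinarith

/-- The integrand in `hyp (1/2) (2/3) (3/2)` has its principal value on the slit as boundary
value from the quadrant that `z ↦ z ^ 2` maps to the lower half-plane. -/
lemma tendsto_euler_factor {t x : ℝ} (h0 : 0 < t) (hx : x < 0) (hne : 1 - t * x ^ 2 ≠ 0) :
    Tendsto (fun ε : ℝ => (1 - (t : ℂ) * ((x : ℂ) + ε * I) ^ 2) ^ (-(1 / 2 : ℂ)))
      (𝓝[>] 0) (𝓝 ((1 - (t : ℂ) * (x : ℂ) ^ 2) ^ (-(1 / 2 : ℂ)))) := by
  have hre : (1 - (t : ℂ) * (x : ℂ) ^ 2) = ((1 - t * x ^ 2 : ℝ) : ℂ) := by push_cast; rfl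
  have hcont : Tendsto (fun ε : ℝ => 1 - (t : ℂ) * ((x : ℂ) + ε * I) ^ 2) (𝓝[>] 0)
      (𝓝 (1 - (t : ℂ) * (x : ℂ) ^ 2)) := by
    have : Continuous (fun ε : ℝ => 1 - (t : ℂ) * ((x : ℂ) + ε * I) ^ 2) := by fun_prop
    simpa using (this.tendsto 0).mono_left nhdsWithin_le_nhds
  have hlog : Tendsto (fun ε : ℝ => Complex.log (1 - (t : ℂ) * ((x : ℂ) + ε * I) ^ 2)) (𝓝[>] 0)
      (𝓝 (Complex.log (1 - (t : ℂ) * (x : ℂ) ^ 2))) := by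
    rcases hne.lt_or_gt with hneg | hpos
    · have hw := Complex.continuousWithinAt_log_of_re_neg_of_im_zero
        (z := 1 - (t : ℂ) * (x : ℂ) ^ 2) (by rw [hre, ofReal_re]; exact hneg)
        (by rw [hre, ofReal_im])
      refine hw.tendsto.comp (tendsto_nhdsWithin_iff.2 ⟨hcont, ?_⟩)
      filter_upwards [self_mem_nhdsWithin] with ε hε
      have e : (1 - (t : ℂ) * ((x : ℂ) + ε * I) ^ 2).im = 2 * t * (-x) * ε := by
        simp [pow_two]; ring
      have hε : 0 < ε := hε
      have hx' : 0 < -x := by linarith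
      show 0 ≤ _
      rw [e]
      positivity
    · refine hcont.clog ?_
      rw [hre]
      exact ofReal_mem_slitPlane.2 hpos
  have hz : (1 - (t : ℂ) * (x : ℂ) ^ 2) ≠ 0 := by
    rw [hre]; exact_mod_cast hne
  have hexp := ((continuous_exp.tendsto _).comp (hlog.mul_const (-(1 / 2 : ℂ))))
  rw [← cpow_def_of_ne_zero hz] at hexp
  refine hexp.congr' ?_
  filter_upwards [hcont.eventually_ne hz] with ε hε
  rw [cpow_def_of_ne_zero hε]
  rfl

lemma ae_one_sub_mul_ne_zero {X : ℝ} (hX : X ≠ 0) :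
    ∀ᵐ t ∂(volume.restrict (Ioo (0 : ℝ) 1)), 1 - t * X ≠ 0 := by
  refine ae_restrict_of_ae ?_
  have : ∀ᵐ t : ℝ, t ≠ 1 / X := by simp [ae_iff]
  filter_upwards [this] with t ht h
  exact ht (by field_simp; linarith)

lemma hyp_half_eq (w : ℂ) :
    hyp (1 / 2) (2 / 3) (3 / 2) w =
      Complex.Gamma (3 / 2) / (Complex.Gamma (2 / 3) * Complex.Gamma (3 / 2 - 2 / 3)) *
        ∫ t in Ioo (0 : ℝ) 1, (t : ℂ) ^ ((2 / 3 : ℂ) - 1) *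
          (1 - (t : ℂ)) ^ ((3 / 2 : ℂ) - 2 / 3 - 1) * (1 - (t : ℂ) * w) ^ (-(1 / 2 : ℂ)) := by
  rw [hyp, intervalIntegral.integral_of_le zero_le_one, integral_Ioc_eq_integral_Ioo]

lemma tendsto_hyp_half {x : ℝ} (hx : x < 0) :
    Tendsto (fun ε : ℝ => hyp (1 / 2) (2 / 3) (3 / 2) (((x : ℂ) + ε * I) ^ 2))
      (𝓝[>] 0) (𝓝 (hyp (1 / 2) (2 / 3) (3 / 2) ((x : ℂ) ^ 2))) := by
  simp_rw [hyp_half_eq]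
  refine Tendsto.const_mul _ ?_
  have hX : 0 < x ^ 2 := by nlinarith
  refine tendsto_integral_filter_of_dominated_convergence _
    (Eventually.of_forall fun ε => Measurable.aestronglyMeasurable (by fun_prop)) ?_
    (integrableOn_euler_majorant hX) ?_
  · refine Eventually.of_forall fun ε => ?_
    filter_upwards [ae_restrict_mem measurableSet_Ioo, ae_one_sub_mul_ne_zero hX.ne'] with t ht hne
    rw [norm_euler_integrand ht.1 ht.2]
    refine le_trans ?_ (euler_kernel_le ht.1 ht.2 (abs_pos.2 hne))
    have h1 : 0 < 1 - t := by linarith [ht.2]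
    have h0 := ht.1
    have := Real.rpow_le_rpow_of_nonpos (z := -(1 / 2)) (abs_pos.2 hne)
      (abs_one_sub_mul_sq_le_norm (x := x) (ε := ε) h0.le) (by norm_num)
    gcongr
  · filter_upwards [ae_restrict_mem measurableSet_Ioo, ae_one_sub_mul_ne_zero hX.ne'] with t ht hne
    exact (tendsto_euler_factor ht.1 hx hne).const_mul _

lemma cpow_neg_half_of_neg {y : ℝ} (hy : y < 0) :
    (y : ℂ) ^ (-(1 / 2 : ℂ)) = -(((-y) ^ (-(1 / 2) : ℝ) : ℝ) : ℂ) * I := by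
  rw [ofReal_cpow_of_nonpos hy.le, ofReal_cpow (by linarith)]
  have : (Real.pi : ℂ) * I * -(1 / 2) = -(Real.pi / 2 * I) := by ring
  rw [this, exp_neg, exp_pi_div_two_mul_I, inv_I]
  push_cast
  ring

lemma im_integral_euler_slit {x : ℝ} (hx : x < -1) :
    (∫ t in Ioo (0 : ℝ) 1, (t : ℂ) ^ ((2 / 3 : ℂ) - 1) *
        (1 - (t : ℂ)) ^ ((3 / 2 : ℂ) - 2 / 3 - 1) *
        (1 - (t : ℂ) * (x : ℂ) ^ 2) ^ (-(1 / 2 : ℂ))).im =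
      -∫ t in Ioo (1 / x ^ 2) 1, t ^ (-(1 / 3) : ℝ) * (1 - t) ^ (-(1 / 6) : ℝ) *
        (t * x ^ 2 - 1) ^ (-(1 / 2) : ℝ) := by
  have hX : 0 < x ^ 2 := by nlinarith
  have hint : IntegrableOn (fun t : ℝ => (t : ℂ) ^ ((2 / 3 : ℂ) - 1) *
        (1 - (t : ℂ)) ^ ((3 / 2 : ℂ) - 2 / 3 - 1) *
        (1 - (t : ℂ) * (x : ℂ) ^ 2) ^ (-(1 / 2 : ℂ))) (Ioo 0 1) := by
    refine Integrable.mono' (integrableOn_euler_majorant hX)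
      (Measurable.aestronglyMeasurable (by fun_prop)) ?_
    filter_upwards [ae_restrict_mem measurableSet_Ioo, ae_one_sub_mul_ne_zero hX.ne'] with t ht hne
    rw [norm_euler_integrand ht.1 ht.2]
    convert euler_kernel_le ht.1 ht.2 (abs_pos.2 hne) using 3
    rw [← Real.norm_eq_abs, ← norm_real]
    push_cast
    rfl
  have hs : Ioo (1 / x ^ 2) 1 = Ioo 0 1 ∩ Ioi (1 / x ^ 2) := by
    ext t
    have : 0 < 1 / x ^ 2 := by positivity
    simp only [mem_Ioo, mem_inter_iff, mem_Ioi]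
    constructor
    · rintro ⟨h1, h2⟩; exact ⟨⟨by linarith, h2⟩, h1⟩
    · rintro ⟨⟨_, h2⟩, h1⟩; exact ⟨h1, h2⟩
  have him := integral_im hint
  simp only [RCLike.im_to_complex] at him
  rw [← him, ← integral_neg, hs, ← setIntegral_indicator measurableSet_Ioi]
  refine integral_congr_ae ?_
  filter_upwards [ae_restrict_mem measurableSet_Ioo, ae_one_sub_mul_ne_zero hX.ne'] with t ht hne
  have h0 := ht.1
  have h1 : 0 < 1 - t := by linarith [ht.2]
  have e1 : (t : ℂ) ^ ((2 / 3 : ℂ) - 1) = ((t ^ (-(1 / 3) : ℝ) : ℝ) : ℂ) := by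
    rw [ofReal_cpow h0.le]; congr 1; push_cast; norm_num
  have e2 : (1 - (t : ℂ)) ^ ((3 / 2 : ℂ) - 2 / 3 - 1) = (((1 - t) ^ (-(1 / 6) : ℝ) : ℝ) : ℂ) := by
    rw [ofReal_cpow h1.le]; push_cast; congr 1; norm_num
  have e3 : (1 - (t : ℂ) * (x : ℂ) ^ 2) = ((1 - t * x ^ 2 : ℝ) : ℂ) := by push_cast; rfl
  rw [e1, e2, e3]
  rcases hne.lt_or_gt with hneg | hpos
  · have hmem : t ∈ Ioi (1 / x ^ 2) := by
      rw [mem_Ioi, div_lt_iff₀ hX]; linarith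
    rw [indicator_of_mem hmem, cpow_neg_half_of_neg hneg, neg_sub, ← ofReal_mul, ← ofReal_neg,
      ← mul_assoc, ← ofReal_mul, im_ofReal_mul, I_im]
    ring
  · have hmem : t ∉ Ioi (1 / x ^ 2) := by
      rw [mem_Ioi, not_lt, le_div_iff₀ hX]; linarith
    rw [indicator_of_notMem hmem]
    have e4 : ((1 - t * x ^ 2 : ℝ) : ℂ) ^ (-(1 / 2 : ℂ)) =
        (((1 - t * x ^ 2) ^ (-(1 / 2) : ℝ) : ℝ) : ℂ) := by
      rw [ofReal_cpow hpos.le]; congr 1; push_cast; rfl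
    rw [e4, ← ofReal_mul, ← ofReal_mul, ofReal_im]

lemma hyp_third_eq {η : ℝ} (h0 : 0 < η) (h1 : η < 1) :
    hyp (1 / 3) (2 / 3) (4 / 3) (η : ℂ) =
      ((Real.Gamma (4 / 3) / (Real.Gamma (2 / 3) * Real.Gamma (2 / 3)) *
        ∫ t in Ioo (0 : ℝ) 1, t ^ ((2 / 3 : ℝ) - 1) * (1 - t) ^ ((1 / 3 : ℝ) - 2 / 3) *
          (1 - t * η) ^ (-(1 / 3 : ℝ)) : ℝ) : ℂ) := by
  rw [hyp, intervalIntegral.integral_of_le zero_le_one, integral_Ioc_eq_integral_Ioo]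
  rw [show (4 / 3 : ℂ) - 2 / 3 = ((2 / 3 : ℝ) : ℂ) by push_cast; norm_num,
    show (4 / 3 : ℂ) = ((4 / 3 : ℝ) : ℂ) by push_cast; rfl,
    show (2 / 3 : ℂ) = ((2 / 3 : ℝ) : ℂ) by push_cast; rfl,
    Complex.Gamma_ofReal, Complex.Gamma_ofReal, ofReal_mul, ← integral_complex_ofReal]
  congr 1
  · push_cast; rfl
  refine setIntegral_congr_fun measurableSet_Ioo fun t ht => ?_
  have hA := ht.1
  have hB : 0 < 1 - t := by linarith [ht.2]
  have hC : 0 < 1 - t * η := by nlinarith [ht.2]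
  rw [ofReal_mul, ofReal_mul, ofReal_cpow hA.le, ofReal_cpow hB.le, ofReal_cpow hC.le]
  push_cast
  norm_num

lemma gamma_constants_eq :
    2 * √3 * Real.Gamma (2 / 3) / (√Real.pi * Real.Gamma (1 / 6)) *
        (Real.Gamma (3 / 2) / (Real.Gamma (2 / 3) * Real.Gamma (5 / 6))) *
        (1 / 3 * beta (5 / 6) (1 / 2) * 4 ^ (1 / 3 : ℝ)) =
      √3 * (3 * Real.Gamma (2 / 3) / Real.Gamma (1 / 3) ^ 2) *
        (Real.Gamma (4 / 3) / (Real.Gamma (2 / 3) * Real.Gamma (2 / 3))) *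
        (1 / 3 * beta (2 / 3) (2 / 3)) := by
  have g16 : 0 < Real.Gamma (1 / 6) := Real.Gamma_pos_of_pos (by norm_num)
  have g13 : 0 < Real.Gamma (1 / 3) := Real.Gamma_pos_of_pos (by norm_num)
  have g23 : 0 < Real.Gamma (2 / 3) := Real.Gamma_pos_of_pos (by norm_num)
  have g56 : 0 < Real.Gamma (5 / 6) := Real.Gamma_pos_of_pos (by norm_num)
  have g43 : Real.Gamma (4 / 3) = 1 / 3 * Real.Gamma (1 / 3) := by
    rw [← Real.Gamma_add_one (by norm_num)]; norm_num
  have g32 : Real.Gamma (3 / 2) = 1 / 2 * √Real.pi := by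
    rw [← Real.Gamma_one_half_eq, ← Real.Gamma_add_one (by norm_num)]; norm_num
  have hπ : 0 < √Real.pi := Real.sqrt_pos.2 Real.pi_pos
  have dup : Real.Gamma (1 / 6) * Real.Gamma (2 / 3) =
      Real.Gamma (1 / 3) * 4 ^ (1 / 3 : ℝ) * √Real.pi := by
    have := Real.Gamma_mul_Gamma_add_half (1 / 6)
    have e : (4 : ℝ) ^ (1 / 3 : ℝ) = 2 ^ (1 - 2 * (1 / 6) : ℝ) := by
      rw [show (4 : ℝ) = 2 ^ (2 : ℝ) by norm_num, ← Real.rpow_mul (by norm_num)]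
      norm_num
    rw [e, show (1 / 3 : ℝ) = 2 * (1 / 6) by norm_num, ← this]
    norm_num
  have b1 : beta (5 / 6) (1 / 2) =
      Real.Gamma (5 / 6) * √Real.pi / (1 / 3 * Real.Gamma (1 / 3)) := by
    rw [beta, Real.Gamma_one_half_eq, ← g43]; norm_num
  have b2 : beta (2 / 3) (2 / 3) =
      Real.Gamma (2 / 3) * Real.Gamma (2 / 3) / (1 / 3 * Real.Gamma (1 / 3)) := by
    rw [beta, ← g43]; norm_num
  rw [b1, b2, g43, g32]
  field_simp
  linear_combination -dup

/-- The imaginary part of the boundary value of `g` on the slit `(-∞, -1)`. -/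
lemma im_boundary_value {x : ℝ} (hx : x < -1) :
    (2 * (Real.sqrt 3 : ℂ) * Complex.Gamma (2 / 3) /
      ((Real.sqrt Real.pi : ℂ) * Complex.Gamma (1 / 6)) * (x : ℂ) *
        hyp (1 / 2) (2 / 3) (3 / 2) ((x : ℂ) ^ 2)).im =
      2 * √3 * Real.Gamma (2 / 3) / (√Real.pi * Real.Gamma (1 / 6)) *
        (Real.Gamma (3 / 2) / (Real.Gamma (2 / 3) * Real.Gamma (5 / 6))) *
        (-x * ∫ t in Ioo (1 / x ^ 2) 1, t ^ (-(1 / 3) : ℝ) * (1 - t) ^ (-(1 / 6) : ℝ) *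
          (t * x ^ 2 - 1) ^ (-(1 / 2) : ℝ)) := by
  have e : ∀ J : ℂ, 2 * (Real.sqrt 3 : ℂ) * Complex.Gamma (2 / 3) /
      ((Real.sqrt Real.pi : ℂ) * Complex.Gamma (1 / 6)) * (x : ℂ) *
      (Complex.Gamma (3 / 2) / (Complex.Gamma (2 / 3) * Complex.Gamma (3 / 2 - 2 / 3)) * J) =
      ((2 * √3 * Real.Gamma (2 / 3) / (√Real.pi * Real.Gamma (1 / 6)) * x *
        (Real.Gamma (3 / 2) / (Real.Gamma (2 / 3) * Real.Gamma (5 / 6))) : ℝ) : ℂ) * J := by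
    intro J
    rw [show (3 / 2 : ℂ) - 2 / 3 = 5 / 6 by norm_num]
    push_cast [← Complex.Gamma_ofReal]
    ring
  rw [hyp_half_eq, e, im_ofReal_mul, im_integral_euler_slit hx]
  ring

theorem stmt_7 (η : ℝ) (hη : η ∈ Set.Ioo (0 : ℝ) 1) :
    ((η + 1) / (η - 1) : ℝ) < -1 ∧
    Filter.Tendsto
      (fun ε : ℝ => ((g ((((η + 1) / (η - 1) : ℝ) : ℂ) + ε * Complex.I)).im : ℂ))
      (nhdsWithin 0 (Set.Ioi 0))
      (nhds ((Real.sqrt 3 : ℂ) *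
        (3 * Complex.Gamma (2/3) / (Complex.Gamma (1/3)) ^ 2) *
        (η : ℂ) ^ ((1 : ℂ)/3) * hyp (1/3) (2/3) (4/3) (η : ℂ))) := by
  obtain ⟨h0, h1⟩ := hη
  have hη : η - 1 < 0 := by linarith
  have hxlt : (η + 1) / (η - 1) < -1 := by
    rw [div_lt_iff_of_neg hη]; linarith
  refine ⟨hxlt, ?_⟩
  have htail := integral_tail_eq h0 h1 rfl
  set x : ℝ := (η + 1) / (η - 1)
  have hz : Tendsto (fun ε : ℝ => (x : ℂ) + ε * I) (𝓝[>] 0) (𝓝 (x : ℂ)) := by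
    have : Continuous (fun ε : ℝ => (x : ℂ) + ε * I) := by fun_prop
    simpa using (this.tendsto 0).mono_left nhdsWithin_le_nhds
  have hg : Tendsto (fun ε : ℝ => g ((x : ℂ) + ε * I)) (𝓝[>] 0) (𝓝 _) :=
    (hz.const_mul _).mul (tendsto_hyp_half (by linarith))
  have hlim := (continuous_ofReal.tendsto _).comp ((continuous_im.tendsto _).comp hg)
  convert (show Tendsto (fun ε : ℝ => ((g ((x : ℂ) + ε * I)).im : ℂ)) _ _ from hlim) using 2
  have hR := integral_euler_eq (a := 2 / 3) (b := 1 / 3) (by norm_num) (by norm_num)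
    (by norm_num) h0 h1
  rw [show (1 / 3 : ℝ) + 1 - 2 / 3 = 2 / 3 by norm_num] at hR
  rw [im_boundary_value hxlt, htail, hyp_third_eq h0 h1]
  have hη3 : (η : ℂ) ^ ((1 : ℂ) / 3) = ((η ^ (1 / 3 : ℝ) : ℝ) : ℂ) := by
    rw [ofReal_cpow h0.le]; push_cast; rfl
  have hreal : √3 * (3 * Real.Gamma (2 / 3) / Real.Gamma (1 / 3) ^ 2) * η ^ (1 / 3 : ℝ) *
      (Real.Gamma (4 / 3) / (Real.Gamma (2 / 3) * Real.Gamma (2 / 3)) *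
        ∫ t in Ioo (0 : ℝ) 1, t ^ ((2 / 3 : ℝ) - 1) * (1 - t) ^ ((1 / 3 : ℝ) - 2 / 3) *
          (1 - t * η) ^ (-(1 / 3 : ℝ))) =
      2 * √3 * Real.Gamma (2 / 3) / (√Real.pi * Real.Gamma (1 / 6)) *
        (Real.Gamma (3 / 2) / (Real.Gamma (2 / 3) * Real.Gamma (5 / 6))) *
      (1 / 3 * beta (5 / 6) (1 / 2) * 4 ^ (1 / 3 : ℝ) *
        ∫ u in Ioo 0 η, u ^ ((1 / 3 : ℝ) - 1) * (1 - u) ^ (-(2 / 3 : ℝ))) := by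
    linear_combination (-∫ u in Ioo 0 η, u ^ ((1 / 3 : ℝ) - 1) * (1 - u) ^ (-(2 / 3 : ℝ))) *
      gamma_constants_eq + √3 * (3 * Real.Gamma (2 / 3) / Real.Gamma (1 / 3) ^ 2) *
      (Real.Gamma (4 / 3) / (Real.Gamma (2 / 3) * Real.Gamma (2 / 3))) * hR
  rw [← hreal, hη3]
  rw [show (1 / 3 : ℂ) = ((1 / 3 : ℝ) : ℂ) by push_cast; rfl,
    show (2 / 3 : ℂ) = ((2 / 3 : ℝ) : ℂ) by push_cast; rfl,
    Complex.Gamma_ofReal, Complex.Gamma_ofReal]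
  push_cast
  rfl
end

section
/- Let u, v ∈ ℂ satisfy Im u ≥ 0, Im v ≥ 0, u ≠ 0, v ≠ 0 and u ≠ conj(v). If (u + conj(v))/(u − conj(v)) ∈ (−∞,−1] ∪ [1,+∞) (i.e., it is real with absolute value at least 1), then u and v are both real and either both positive or both negative. Equivalently, this can only happen when u·v is a positive real number. -/
open Complex Set Filter

theorem stmt_10 (u v : ℂ) (hu : 0 ≤ u.im) (hv : 0 ≤ v.im)
    (hu0 : u ≠ 0) (hv0 : v ≠ 0) (huv : u ≠ (starRingEnd ℂ) v)
    (h : (u + (starRingEnd ℂ) v) / (u - (starRingEnd ℂ) v) ∈ slit) :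
    (u.im = 0 ∧ v.im = 0 ∧
      ((0 < u.re ∧ 0 < v.re) ∨ (u.re < 0 ∧ v.re < 0))) ∧
    ((u * v).im = 0 ∧ 0 < (u * v).re) := by
  set t := (u + (starRingEnd ℂ) v) / (u - (starRingEnd ℂ) v)
  obtain ⟨ht_im, ht_re⟩ := h
  have hmul : t * (u - (starRingEnd ℂ) v) = u + (starRingEnd ℂ) v :=
    div_mul_cancel₀ _ (sub_ne_zero.mpr huv)
  have hre : u.re * (t.re - 1) = v.re * (t.re + 1) := by
    have := congrArg Complex.re hmul
    simp only [mul_re, sub_re, add_re, conj_re, ht_im] at this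
    linarith
  have him : u.im * (t.re - 1) = -(v.im * (t.re + 1)) := by
    have := congrArg Complex.im hmul
    simp only [mul_im, sub_im, sub_re, add_im, conj_im, conj_re, ht_im] at this
    linarith
  clear_value t
  have ht_one : t.re ≠ 1 := fun h1 => hv0 <| by
    rw [h1] at hre him
    apply Complex.ext <;> simp only [zero_re, zero_im] <;> linarith
  have ht_neg_one : t.re ≠ -1 := fun h1 => hu0 <| by
    rw [h1] at hre him
    apply Complex.ext <;> simp only [zero_re, zero_im] <;> linarith
  have hpos : 0 < (t.re - 1) * (t.re + 1) := by
    rcases ht_re with h1 | h1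
    · have := lt_of_le_of_ne h1 ht_neg_one
      exact mul_pos_of_neg_of_neg (by linarith) (by linarith)
    · have := lt_of_le_of_ne h1 ht_one.symm
      exact mul_pos (by linarith) (by linarith)
  have hsq : 0 < (t.re - 1) ^ 2 := sq_pos_of_ne_zero (sub_ne_zero.mpr ht_one)
  have hprod : u.im * (t.re - 1) ^ 2 + v.im * ((t.re - 1) * (t.re + 1)) = 0 := by
    linear_combination (t.re - 1) * him
  have hu_im : u.im = 0 := by
    by_contra hne
    have := mul_pos (lt_of_le_of_ne hu (Ne.symm hne)) hsq
    have := mul_nonneg hv hpos.le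
    linarith
  have hv_im : v.im = 0 := by
    rw [hu_im, zero_mul, zero_add] at hprod
    exact (mul_eq_zero.mp hprod).resolve_right hpos.ne'
  have hv_re : v.re ≠ 0 := fun h0 => hv0 (Complex.ext h0 hv_im)
  have huv_re : 0 < u.re * v.re := by
    have h1 : u.re * v.re * (t.re - 1) ^ 2 = v.re ^ 2 * ((t.re - 1) * (t.re + 1)) := by
      linear_combination v.re * (t.re - 1) * hre
    exact pos_of_mul_pos_left (h1 ▸ mul_pos (sq_pos_of_ne_zero hv_re) hpos) hsq.le
  refine ⟨⟨hu_im, hv_im, mul_pos_iff.mp huv_re⟩, ?_, ?_⟩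
  · simp [mul_im, hu_im, hv_im]
  · simpa [mul_re, hu_im, hv_im] using huv_re
end

section
/- For all real numbers u, v with u < 0 < v, one has (u+v)/(u−v) ∈ (−1,1) and g((u+v)/(u−v)) ∈ (−1,1) (in particular the value of g is real). -/
open Complex Set Filter

/-- The real integrand of Euler's integral for `₂F₁(1/2, 2/3; 3/2; y)`. -/
noncomputable def eulerIntegrand (y t : ℝ) : ℝ :=
  t ^ (-(1/3) : ℝ) * (1 - t) ^ (-(1/6) : ℝ) * (1 - t * y) ^ (-(1/2) : ℝ)

lemma eulerIntegrand_nonneg {y t : ℝ} (hy : y ≤ 1) (ht : t ∈ Icc (0 : ℝ) 1) :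
    0 ≤ eulerIntegrand y t := by
  have h1 : 0 ≤ 1 - t := by linarith [ht.2]
  have h2 : 0 ≤ 1 - t * y := by nlinarith [ht.1, ht.2]
  have h0 := ht.1
  unfold eulerIntegrand
  positivity

lemma eulerIntegrand_le_one {y t : ℝ} (hy : y ≤ 1) (ht : t ∈ Icc (0 : ℝ) 1) :
    eulerIntegrand y t ≤ eulerIntegrand 1 t := by
  have h0 := ht.1
  unfold eulerIntegrand
  rcases ht.2.eq_or_lt with rfl | h
  · simp [Real.zero_rpow]
  · have h1 : 0 < 1 - t := by linarith
    refine mul_le_mul_of_nonneg_left ?_ (by positivity)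
    exact Real.rpow_le_rpow_of_nonpos (by linarith) (by nlinarith) (by norm_num)

lemma ofReal_eulerIntegrand {y t : ℝ} (hy : y ≤ 1) (ht : t ∈ Icc (0 : ℝ) 1) :
    ((eulerIntegrand y t : ℝ) : ℂ) = (t : ℂ) ^ ((2/3 : ℂ) - 1) *
      (1 - (t : ℂ)) ^ ((3/2 : ℂ) - 2/3 - 1) * (1 - (t : ℂ) * y) ^ (-(1/2) : ℂ) := by
  have h1 : 0 ≤ 1 - t := by linarith [ht.2]
  have h2 : 0 ≤ 1 - t * y := by nlinarith [ht.1, ht.2]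
  unfold eulerIntegrand
  push_cast [Complex.ofReal_cpow ht.1, Complex.ofReal_cpow h1, Complex.ofReal_cpow h2]
  norm_num

lemma ofReal_eulerIntegrand_one {t : ℝ} (ht : t ∈ Icc (0 : ℝ) 1) :
    ((eulerIntegrand 1 t : ℝ) : ℂ) =
      (t : ℂ) ^ ((2/3 : ℂ) - 1) * (1 - (t : ℂ)) ^ ((1/3 : ℂ) - 1) := by
  have h1 : 0 ≤ 1 - t := by linarith [ht.2]
  have key : eulerIntegrand 1 t = t ^ (-(1/3) : ℝ) * (1 - t) ^ (-(2/3) : ℝ) := by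
    unfold eulerIntegrand
    rw [mul_one, mul_assoc, ← Real.rpow_add' h1 (by norm_num)]
    norm_num
  rw [key]
  push_cast [Complex.ofReal_cpow ht.1, Complex.ofReal_cpow h1]
  norm_num

lemma intervalIntegrable_eulerIntegrand_one :
    IntervalIntegrable (eulerIntegrand 1) MeasureTheory.volume 0 1 := by
  have h := Complex.betaIntegral_convergent (u := 2/3) (v := 1/3) (by norm_num) (by norm_num)
  have h' : IntervalIntegrable (fun t : ℝ => ((eulerIntegrand 1 t : ℝ) : ℂ))
      MeasureTheory.volume 0 1 := by
    refine h.congr fun t ht => ?_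
    rw [uIoc_of_le zero_le_one] at ht
    exact (ofReal_eulerIntegrand_one ⟨ht.1.le, ht.2⟩).symm
  rw [intervalIntegrable_iff] at h' ⊢
  exact h'.re

lemma ofReal_integral_eulerIntegrand {y : ℝ} (hy : y ≤ 1) :
    ((∫ t in (0 : ℝ)..1, eulerIntegrand y t : ℝ) : ℂ) =
      ∫ t in (0 : ℝ)..1, (t : ℂ) ^ ((2/3 : ℂ) - 1) *
        (1 - (t : ℂ)) ^ ((3/2 : ℂ) - 2/3 - 1) * (1 - (t : ℂ) * y) ^ (-(1/2) : ℂ) := by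
  rw [← intervalIntegral.integral_ofReal]
  refine intervalIntegral.integral_congr fun t ht => ?_
  rw [uIcc_of_le zero_le_one] at ht
  exact ofReal_eulerIntegrand hy ht

lemma integral_eulerIntegrand_one :
    ∫ t in (0 : ℝ)..1, eulerIntegrand 1 t = 2 * Real.pi / √3 := by
  have h : ((∫ t in (0 : ℝ)..1, eulerIntegrand 1 t : ℝ) : ℂ) = Complex.betaIntegral (2/3) (1/3) := by
    rw [← intervalIntegral.integral_ofReal, Complex.betaIntegral]
    refine intervalIntegral.integral_congr fun t ht => ?_
    rw [uIcc_of_le zero_le_one] at ht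
    exact ofReal_eulerIntegrand_one ht
  have hG := Complex.Gamma_mul_Gamma_eq_betaIntegral (s := 2/3) (t := 1/3)
    (by norm_num) (by norm_num)
  have hR := Complex.Gamma_mul_Gamma_one_sub (1/3)
  rw [show (1 : ℂ) - 1/3 = 2/3 by norm_num, mul_comm, hG,
    show (2/3 : ℂ) + 1/3 = 1 by norm_num, Complex.Gamma_one, one_mul, ← h,
    show (Real.pi : ℂ) * (1/3) = ((Real.pi / 3 : ℝ) : ℂ) by push_cast; ring,
    ← Complex.ofReal_sin, Real.sin_pi_div_three] at hR
  have hR' : ∫ t in (0 : ℝ)..1, eulerIntegrand 1 t = Real.pi / (√3 / 2) := by exact_mod_cast hR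
  rw [hR']
  field_simp

lemma integral_eulerIntegrand_nonneg {y : ℝ} (hy : y ≤ 1) :
    0 ≤ ∫ t in (0 : ℝ)..1, eulerIntegrand y t :=
  intervalIntegral.integral_nonneg zero_le_one fun _ ht => eulerIntegrand_nonneg hy ht

lemma integral_eulerIntegrand_le {y : ℝ} (hy : y ≤ 1) :
    ∫ t in (0 : ℝ)..1, eulerIntegrand y t ≤ 2 * Real.pi / √3 := by
  rw [← integral_eulerIntegrand_one, intervalIntegral.integral_of_le zero_le_one,
    intervalIntegral.integral_of_le zero_le_one]
  refine MeasureTheory.integral_mono_of_nonneg ?_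
    ((intervalIntegrable_iff_integrableOn_Ioc_of_le zero_le_one).1
      intervalIntegrable_eulerIntegrand_one) ?_
  · filter_upwards [MeasureTheory.ae_restrict_mem measurableSet_Ioc] with t ht
    exact eulerIntegrand_nonneg hy ⟨ht.1.le, ht.2⟩
  · filter_upwards [MeasureTheory.ae_restrict_mem measurableSet_Ioc] with t ht
    exact eulerIntegrand_le_one hy ⟨ht.1.le, ht.2⟩

lemma g_ofReal {x : ℝ} (hx : x ^ 2 ≤ 1) :
    g (x : ℂ) =
      ((x * (√3 / (2 * Real.pi) * ∫ t in (0 : ℝ)..1, eulerIntegrand (x ^ 2) t) : ℝ) : ℂ) := by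
  have h56 := Complex.Gamma_mul_Gamma_one_sub (1/6)
  rw [show (1 : ℂ) - 1/6 = 5/6 by norm_num,
    show (Real.pi : ℂ) * (1/6) = ((Real.pi / 6 : ℝ) : ℂ) by push_cast; ring,
    ← Complex.ofReal_sin, Real.sin_pi_div_six] at h56
  have h32 : Complex.Gamma (3/2) = 1/2 * (√Real.pi : ℂ) := by
    rw [show (3/2 : ℂ) = 1/2 + 1 by norm_num, Complex.Gamma_add_one _ (by norm_num),
      show (1/2 : ℂ) = ((1/2 : ℝ) : ℂ) by norm_num, Complex.Gamma_ofReal, Real.Gamma_one_half_eq]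
  have hpi : (√Real.pi : ℂ) ≠ 0 := by exact_mod_cast (Real.sqrt_pos.2 Real.pi_pos).ne'
  have hpi' : (Real.pi : ℂ) ≠ 0 := by exact_mod_cast Real.pi_ne_zero
  have h16 : Complex.Gamma (1/6) ≠ 0 := Complex.Gamma_ne_zero_of_re_pos (by norm_num)
  have h23 : Complex.Gamma (2/3) ≠ 0 := Complex.Gamma_ne_zero_of_re_pos (by norm_num)
  have h56' : Complex.Gamma (5/6) = 2 * Real.pi / Complex.Gamma (1/6) := by
    rw [eq_div_iff h16, mul_comm, h56]
    push_cast
    ring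
  unfold g hyp
  rw [← Complex.ofReal_pow, ← ofReal_integral_eulerIntegrand hx, h32,
    show (3/2 : ℂ) - 2/3 = 5/6 by norm_num, h56']
  push_cast
  field_simp

theorem stmt_11 (u v : ℝ) (hu : u < 0) (hv : 0 < v) :
    (u + v) / (u - v) ∈ Set.Ioo (-1 : ℝ) 1 ∧
    (g (((u + v) / (u - v) : ℝ) : ℂ)).im = 0 ∧
    (g (((u + v) / (u - v) : ℝ) : ℂ)).re ∈ Set.Ioo (-1 : ℝ) 1 := by
  have hd : u - v < 0 := by linarith
  have hx : (u + v) / (u - v) ∈ Set.Ioo (-1 : ℝ) 1 :=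
    ⟨by rw [lt_div_iff_of_neg hd]; linarith, by rw [div_lt_iff_of_neg hd]; linarith⟩
  set x := (u + v) / (u - v)
  have hx2 : x ^ 2 ≤ 1 := by nlinarith [hx.1, hx.2]
  have hI0 := integral_eulerIntegrand_nonneg hx2
  have hI1 := integral_eulerIntegrand_le hx2
  have hc0 : 0 ≤ √3 / (2 * Real.pi) := by positivity
  have hc1 : √3 / (2 * Real.pi) * (2 * Real.pi / √3) = 1 := by
    have := Real.pi_ne_zero
    field_simp
  have h0 := mul_nonneg hc0 hI0
  have h1 := (mul_le_mul_of_nonneg_left hI1 hc0).trans_eq hc1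
  rw [g_ofReal hx2, Complex.ofReal_im, Complex.ofReal_re]
  refine ⟨hx, rfl, abs_lt.1 ?_⟩
  rw [abs_mul, abs_of_nonneg h0]
  exact (mul_le_of_le_one_right (abs_nonneg x) h1).trans_lt (abs_lt.2 hx)
end

section
/- For all real numbers u, v with 0 < u < v, one has x := (u+v)/(u−v) ∈ (−∞,−1), the limit lim_{ε→0+} g(x − iε) (the boundary value of g from the lower half-plane) exists, and this limit lies on the closed straight segment joining −1 and −i√3. -/
open Complex Set Filter

/-- The Euler integral `∫₀¹ t^(a-1) (1-t)^(b-1) (1-tk)^(-c) dt` over the reals. -/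
noncomputable def eulerIntegral (a b c k : ℝ) : ℝ :=
  ∫ t in Ioo (0 : ℝ) 1, t ^ (a - 1) * (1 - t) ^ (b - 1) * (1 - t * k) ^ (-c)

lemma ofReal_betaIntegrand {a b t : ℝ} (ht : t ∈ Ioo (0 : ℝ) 1) :
    (t : ℂ) ^ ((a : ℂ) - 1) * (1 - (t : ℂ)) ^ ((b : ℂ) - 1)
      = ((t ^ (a - 1) * (1 - t) ^ (b - 1) : ℝ) : ℂ) := by
  rw [ofReal_mul, ofReal_cpow ht.1.le, ofReal_cpow (sub_nonneg.2 ht.2.le)]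
  push_cast
  rfl

lemma integrableOn_betaIntegrand {a b : ℝ} (ha : 0 < a) (hb : 0 < b) :
    MeasureTheory.IntegrableOn (fun t : ℝ => t ^ (a - 1) * (1 - t) ^ (b - 1)) (Ioo 0 1) := by
  have h := betaIntegral_convergent (u := a) (v := b) (by simpa) (by simpa)
  rw [intervalIntegrable_iff_integrableOn_Ioo_of_le zero_le_one] at h
  refine MeasureTheory.IntegrableOn.congr_fun h.re (fun t ht => ?_) measurableSet_Ioo
  change (_ : ℂ).re = _
  rw [ofReal_betaIntegrand ht, ofReal_re]

lemma integral_betaIntegrand {a b : ℝ} (ha : 0 < a) (hb : 0 < b) :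
    ∫ t in Ioo (0 : ℝ) 1, t ^ (a - 1) * (1 - t) ^ (b - 1) = ProbabilityTheory.beta a b := by
  rw [ProbabilityTheory.beta_eq_betaIntegralReal a b ha hb, betaIntegral,
    intervalIntegral.integral_of_le zero_le_one, MeasureTheory.integral_Ioc_eq_integral_Ioo,
    MeasureTheory.setIntegral_congr_fun measurableSet_Ioo (fun t ht => ofReal_betaIntegrand ht),
    integral_complex_ofReal, ofReal_re]

lemma one_sub_mul_pos {t k : ℝ} (ht : t ∈ Ioo (0 : ℝ) 1) (hk : k ≤ 1) : 0 < 1 - t * k := by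
  nlinarith [ht.1, ht.2]

lemma integrableOn_eulerIntegrand {a b k : ℝ} (ha : 0 < a) (hb : 0 < b) (c : ℝ) (hk : k < 1) :
    MeasureTheory.IntegrableOn
      (fun t : ℝ => t ^ (a - 1) * (1 - t) ^ (b - 1) * (1 - t * k) ^ (-c)) (Ioo 0 1) := by
  have h := integrableOn_betaIntegrand ha hb
  rw [← integrableOn_Icc_iff_integrableOn_Ioo] at h ⊢
  refine h.mul_continuousOn ?_ isCompact_Icc
  refine ContinuousOn.rpow_const (by fun_prop) fun t ht => Or.inl (ne_of_gt ?_)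
  rcases ht.2.eq_or_lt with rfl | h1
  · linarith
  · nlinarith [ht.1]

lemma eulerIntegral_add {a b k : ℝ} (ha : 0 < a) (hb : 0 < b) (hk : k < 1) :
    eulerIntegral a b (a + b) k = ProbabilityTheory.beta a b * (1 - k) ^ (-a) := by
  have hk' : 0 < 1 - k := sub_pos.2 hk
  set f : ℝ → ℝ := fun t => t * (1 - k) / (1 - t * k)
  have himg : f '' Ioo 0 1 = Ioo 0 1 := by
    apply Subset.antisymm
    · rintro _ ⟨t, ht, rfl⟩
      have hp := one_sub_mul_pos ht hk.le
      refine ⟨div_pos (mul_pos ht.1 hk') hp, ?_⟩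
      rw [div_lt_one hp]
      nlinarith [ht.2]
    · intro s hs
      have hp : 0 < 1 - k + s * k := by nlinarith [hs.1, hs.2]
      refine ⟨s / (1 - k + s * k), ⟨div_pos hs.1 hp, ?_⟩, ?_⟩
      · rw [div_lt_one hp]
        nlinarith [hs.2]
      · have : 1 - s / (1 - k + s * k) * k = (1 - k) / (1 - k + s * k) := by
          field_simp
          ring
        simp only [f, this]
        field_simp
  have hder : ∀ t ∈ Ioo (0 : ℝ) 1,
      HasDerivWithinAt f ((1 - k) / (1 - t * k) ^ 2) (Ioo 0 1) t := by
    intro t ht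
    have hp := one_sub_mul_pos ht hk.le
    have := (((hasDerivAt_id t).mul_const (1 - k)).div
      (((hasDerivAt_id t).mul_const k).const_sub 1) hp.ne').hasDerivWithinAt (s := Ioo 0 1)
    refine this.congr_deriv ?_
    simp only [id]
    congr 1
    ring
  have hinj : InjOn f (Ioo 0 1) := by
    intro t ht s hs h
    have hp := one_sub_mul_pos ht hk.le
    have hq := one_sub_mul_pos hs hk.le
    simp only [f] at h
    rw [div_eq_div_iff hp.ne' hq.ne'] at h
    have : (t - s) * (1 - k) = 0 := by linarith
    rcases mul_eq_zero.1 this with h | h <;> linarith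
  have key := MeasureTheory.integral_image_eq_integral_abs_deriv_smul measurableSet_Ioo hder hinj
    (fun s : ℝ => s ^ (a - 1) * (1 - s) ^ (b - 1))
  rw [himg, integral_betaIntegrand ha hb] at key
  rw [key, ← MeasureTheory.integral_mul_const, eulerIntegral]
  refine MeasureTheory.setIntegral_congr_fun measurableSet_Ioo fun t ht => ?_
  have hp := one_sub_mul_pos ht hk.le
  have h1 : 1 - f t = (1 - t) / (1 - t * k) := by
    simp only [f]
    field_simp
    ring
  have ht' : 0 < 1 - t := sub_pos.2 ht.2
  simp only [smul_eq_mul, h1]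
  rw [abs_of_pos (by positivity)]
  simp only [f]
  rw [Real.div_rpow (by nlinarith [ht.1]) hp.le, Real.div_rpow ht'.le hp.le,
    Real.mul_rpow ht.1.le hk'.le, Real.rpow_sub hk' a, Real.rpow_sub hp a, Real.rpow_sub hp b,
    Real.rpow_neg hp.le, Real.rpow_neg hk'.le, Real.rpow_add hp]
  simp only [Real.rpow_one]
  have := Real.rpow_pos_of_pos hp a
  have := Real.rpow_pos_of_pos hp b
  have := Real.rpow_pos_of_pos hk' a
  field_simp

lemma hasDerivAt_eulerIntegral {a b c k : ℝ} (ha : 0 < a) (hb : 0 < b) (hc : c + 1 = a + b)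
    (hk : k ∈ Ioo (0 : ℝ) 1) :
    HasDerivAt (fun k => k ^ c * eulerIntegral a b c k)
      (c * k ^ (c - 1) * (ProbabilityTheory.beta a b * (1 - k) ^ (-a))) k := by
  have hbeta := integrableOn_betaIntegrand ha hb
  obtain ⟨M, hM⟩ := (isCompact_Icc (a := k / 2) (b := (1 + k) / 2)).prod
    (isCompact_Icc (a := (0 : ℝ)) (b := 1)) |>.exists_bound_of_continuousOn
      (f := fun p : ℝ × ℝ => c * p.1 ^ (c - 1) * (1 - p.2 * p.1) ^ (-(a + b))) (by
      refine ContinuousOn.mul (ContinuousOn.mul continuousOn_const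
        (ContinuousOn.rpow_const (by fun_prop) ?_)) (ContinuousOn.rpow_const (by fun_prop) ?_)
      · rintro ⟨x, t⟩ ⟨⟨h1, h2⟩, h3, h4⟩
        left
        dsimp only at *
        linarith [hk.1]
      · rintro ⟨x, t⟩ ⟨⟨h1, h2⟩, h3, h4⟩
        left
        dsimp only at *
        have := hk.1
        have := hk.2
        nlinarith)
  have main := hasDerivAt_integral_of_dominated_loc_of_deriv_le
    (μ := MeasureTheory.volume.restrict (Ioo (0 : ℝ) 1)) (x₀ := k)
    (s := Icc (k / 2) ((1 + k) / 2))
    (F := fun x t => x ^ c * (t ^ (a - 1) * (1 - t) ^ (b - 1) * (1 - t * x) ^ (-c)))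
    (F' := fun x t => c * x ^ (c - 1) * (t ^ (a - 1) * (1 - t) ^ (b - 1) *
      (1 - t * x) ^ (-(a + b))))
    (bound := fun t => ‖t ^ (a - 1) * (1 - t) ^ (b - 1)‖ * M)
    (Icc_mem_nhds (by linarith [hk.1]) (by linarith [hk.2]))
    (Eventually.of_forall fun x => by
      apply Measurable.aestronglyMeasurable
      fun_prop)
    ((integrableOn_eulerIntegrand ha hb c hk.2).const_mul _)
    (by
      apply Measurable.aestronglyMeasurable
      fun_prop)
    (by
      filter_upwards [MeasureTheory.ae_restrict_mem measurableSet_Ioo] with t ht x hx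
      have := hM (x, t) ⟨hx, Ioo_subset_Icc_self ht⟩
      calc _ = ‖t ^ (a - 1) * (1 - t) ^ (b - 1)‖ *
            ‖c * x ^ (c - 1) * (1 - t * x) ^ (-(a + b))‖ := by
            rw [← norm_mul]
            congr 1
            ring
        _ ≤ _ := by gcongr)
    (hbeta.norm.mul_const M)
    (by
      filter_upwards [MeasureTheory.ae_restrict_mem measurableSet_Ioo] with t ht x hx
      have hx0 : 0 < x := by linarith [hk.1, hx.1]
      have hx1 : x ≤ 1 := by linarith [hk.2, hx.2]
      have hp := one_sub_mul_pos ht hx1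
      have h1 := Real.hasDerivAt_rpow_const (x := x) (p := c) (Or.inl hx0.ne')
      have h2 := (((hasDerivAt_id x).const_mul t).const_sub 1).rpow_const (p := -c)
        (Or.inl hp.ne')
      refine (h1.mul (h2.const_mul (t ^ (a - 1) * (1 - t) ^ (b - 1)))).congr_deriv ?_
      simp only [id]
      rw [← hc, show -c - 1 = -(c + 1) by ring,
        show (1 - t * x) ^ (-c) = (1 - t * x) ^ (-(c + 1)) * (1 - t * x) by
          rw [← Real.rpow_add_one hp.ne']
          congr 1
          ring,
        show x ^ c = x ^ (c - 1) * x by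
          rw [← Real.rpow_add_one hx0.ne']
          congr 1
          ring]
      ring)
  have h := main.2
  rw [MeasureTheory.integral_const_mul] at h
  simp only [MeasureTheory.integral_const_mul] at h
  rw [← eulerIntegral_add ha hb hk.2]
  exact h

lemma continuousOn_eulerIntegral {a b c K : ℝ} (hc : 0 ≤ c) (hK : K ≤ 1)
    (hint : MeasureTheory.IntegrableOn
      (fun t : ℝ => t ^ (a - 1) * (1 - t) ^ (b - 1) * (1 - t * K) ^ (-c)) (Ioo 0 1)) :
    ContinuousOn (eulerIntegral a b c) (Icc 0 K) := by
  intro k hk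
  refine MeasureTheory.continuousWithinAt_of_dominated (bound := fun t : ℝ =>
    t ^ (a - 1) * (1 - t) ^ (b - 1) * (1 - t * K) ^ (-c)) ?_ ?_ hint ?_
  · refine Eventually.of_forall fun x => Measurable.aestronglyMeasurable ?_
    fun_prop
  · filter_upwards [self_mem_nhdsWithin] with x hx
    filter_upwards [MeasureTheory.ae_restrict_mem measurableSet_Ioo] with t ht
    have hp := one_sub_mul_pos ht (hx.2.trans hK)
    have hq := one_sub_mul_pos ht hK
    have ht' : 0 < 1 - t := sub_pos.2 ht.2
    have ht0 := ht.1
    rw [Real.norm_of_nonneg (by positivity)]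
    refine mul_le_mul_of_nonneg_left ?_ (by positivity)
    exact Real.rpow_le_rpow_of_nonpos hq (by nlinarith [hx.2]) (by linarith)
  · filter_upwards [MeasureTheory.ae_restrict_mem measurableSet_Ioo] with t ht
    have hp := one_sub_mul_pos ht (hk.2.trans hK)
    refine ContinuousAt.continuousWithinAt ?_
    exact continuousAt_const.mul (ContinuousAt.rpow_const (by fun_prop) (Or.inl hp.ne'))

lemma sqrt_three_mul_beta :
    √3 * (1 / 6) * ProbabilityTheory.beta (2 / 3) (1 / 2) =
      1 / 3 * ProbabilityTheory.beta (5 / 6) (1 / 2) := by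
  have h1 : Real.Gamma (7 / 6) = 1 / 6 * Real.Gamma (1 / 6) := by
    rw [← Real.Gamma_add_one (by norm_num)]
    norm_num
  have h2 : Real.Gamma (4 / 3) = 1 / 3 * Real.Gamma (1 / 3) := by
    rw [← Real.Gamma_add_one (by norm_num)]
    norm_num
  have h3 := Real.Gamma_mul_Gamma_one_sub (1 / 6)
  have h4 := Real.Gamma_mul_Gamma_one_sub (1 / 3)
  rw [show Real.pi * (1 / 6) = Real.pi / 6 by ring, Real.sin_pi_div_six] at h3
  rw [show Real.pi * (1 / 3) = Real.pi / 3 by ring, Real.sin_pi_div_three] at h4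
  norm_num at h3 h4
  have p1 := Real.Gamma_pos_of_pos (show (0 : ℝ) < 1 / 6 by norm_num)
  have p2 := Real.Gamma_pos_of_pos (show (0 : ℝ) < 1 / 3 by norm_num)
  have s3 : √3 * √3 = 3 := Real.mul_self_sqrt (by norm_num)
  have s3' : 0 < √3 := by positivity
  rw [ProbabilityTheory.beta, ProbabilityTheory.beta]
  norm_num only
  rw [h1, h2]
  field_simp at h4 ⊢
  norm_num only at h3 h4 p1 p2 ⊢
  have key : √3 * (Real.Gamma (1 / 3) * Real.Gamma (2 / 3)) =
      Real.Gamma (1 / 6) * Real.Gamma (5 / 6) := by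
    rw [h3]
    linarith
  nlinarith [key]

lemma sqrt_three_mul_eulerIntegral_add {k : ℝ} (hk : k ∈ Ioo (0 : ℝ) 1) :
    √3 * (k ^ (1 / 6 : ℝ) * eulerIntegral (2 / 3) (1 / 2) (1 / 6) k) +
      (1 - k) ^ (1 / 3 : ℝ) * eulerIntegral (5 / 6) (1 / 2) (1 / 3) (1 - k) = 2 * Real.pi := by
  have hend : ∀ t ∈ Ioo (0 : ℝ) 1,
      t ^ (5 / 6 - 1 : ℝ) * (1 - t) ^ (1 / 6 - 1 : ℝ) =
      t ^ (5 / 6 - 1 : ℝ) * (1 - t) ^ (1 / 2 - 1 : ℝ) * (1 - t * 1) ^ (-(1 / 3) : ℝ) := by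
    intro t ht
    rw [mul_one, mul_assoc, ← Real.rpow_add (sub_pos.2 ht.2)]
    norm_num
  have hcont1 := continuousOn_eulerIntegral (a := 2 / 3) (b := 1 / 2) (c := 1 / 6) (by norm_num)
    hk.2.le (integrableOn_eulerIntegrand (by norm_num) (by norm_num) _ hk.2)
  have hcont2 := continuousOn_eulerIntegral (a := 5 / 6) (b := 1 / 2) (c := 1 / 3) (by norm_num)
    le_rfl ((integrableOn_betaIntegrand (a := 5 / 6) (b := 1 / 6) (by norm_num)
      (by norm_num)).congr_fun hend measurableSet_Ioo)
  obtain ⟨y, hy, hslope⟩ := exists_hasDerivAt_eq_slope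
    (fun k : ℝ => √3 * (k ^ (1 / 6 : ℝ) * eulerIntegral (2 / 3) (1 / 2) (1 / 6) k) +
      (1 - k) ^ (1 / 3 : ℝ) * eulerIntegral (5 / 6) (1 / 2) (1 / 3) (1 - k)) (fun _ => 0) hk.1
    (by
      refine ContinuousOn.add (continuousOn_const.mul (ContinuousOn.mul
        (ContinuousOn.rpow_const (by fun_prop) (by norm_num)) hcont1)) (ContinuousOn.mul
        (ContinuousOn.rpow_const (by fun_prop) (by norm_num)) (hcont2.comp (by fun_prop) ?_))
      intro x hx
      exact ⟨by linarith [hx.2, hk.2], by linarith [hx.1]⟩)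
    (by
      intro x hx
      have hx1 : x ∈ Ioo (0 : ℝ) 1 := ⟨hx.1, hx.2.trans hk.2⟩
      have d1 := hasDerivAt_eulerIntegral (a := 2 / 3) (b := 1 / 2) (c := 1 / 6) (by norm_num)
        (by norm_num) (by norm_num) hx1
      have d2 := hasDerivAt_eulerIntegral (a := 5 / 6) (b := 1 / 2) (c := 1 / 3) (k := 1 - x)
        (by norm_num) (by norm_num) (by norm_num) ⟨sub_pos.2 hx1.2, by linarith [hx1.1]⟩
      refine ((d1.const_mul √3).add
        (d2.comp x ((hasDerivAt_id x).const_sub 1))).congr_deriv ?_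
      norm_num only [sub_sub_cancel]
      linear_combination x ^ (-(5 / 6) : ℝ) * (1 - x) ^ (-(2 / 3) : ℝ) * sqrt_three_mul_beta)
  have hk0 := hk.1.ne'
  rw [eq_div_iff (by simpa using hk0), zero_mul] at hslope
  have h0 : eulerIntegral (5 / 6) (1 / 2) (1 / 3) 1 = 2 * Real.pi := by
    rw [eulerIntegral, ← MeasureTheory.setIntegral_congr_fun measurableSet_Ioo hend,
      integral_betaIntegrand (by norm_num) (by norm_num), ProbabilityTheory.beta]
    have h3 := Real.Gamma_mul_Gamma_one_sub (1 / 6)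
    rw [show Real.pi * (1 / 6) = Real.pi / 6 by ring, Real.sin_pi_div_six] at h3
    norm_num at h3 ⊢
    linarith
  have hz : (0 : ℝ) ^ (1 / 6 : ℝ) = 0 := Real.zero_rpow (by norm_num)
  simp only [sub_zero] at hslope
  rw [hz, h0, Real.one_rpow] at hslope
  linarith

/-- The common modulus of the boundary integrand of `hyp (1/2) (2/3) (3/2)` at `1/k`, up to the
factor `√k`. -/
noncomputable def slitWeight (k t : ℝ) : ℝ :=
  t ^ (-(1 / 3) : ℝ) * (1 - t) ^ (-(1 / 6) : ℝ) * |k - t| ^ (-(1 / 2) : ℝ)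

lemma slitWeight_nonneg {k t : ℝ} (ht : t ∈ Icc (0 : ℝ) 1) : 0 ≤ slitWeight k t := by
  have := ht.1
  have : 0 ≤ 1 - t := sub_nonneg.2 ht.2
  unfold slitWeight
  positivity

lemma slitWeight_mul {k s : ℝ} (hk : 0 < k) (hs : s ∈ Ioo (0 : ℝ) 1) :
    slitWeight k (k * s) = k ^ (-(5 / 6) : ℝ) *
      (s ^ (2 / 3 - 1 : ℝ) * (1 - s) ^ (1 / 2 - 1 : ℝ) * (1 - s * k) ^ (-(1 / 6) : ℝ)) := by
  have hs' : 0 < 1 - s := sub_pos.2 hs.2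
  rw [slitWeight, show k - k * s = k * (1 - s) by ring, abs_of_pos (by positivity),
    Real.mul_rpow hk.le hs.1.le, Real.mul_rpow hk.le hs'.le,
    show (-(5 / 6) : ℝ) = -(1 / 3) + -(1 / 2) by norm_num, Real.rpow_add hk, mul_comm s k]
  norm_num only
  ring

lemma slitWeight_one_sub_mul {k s : ℝ} (hk : k < 1) (hs : s ∈ Ioo (0 : ℝ) 1) :
    slitWeight k (1 - (1 - k) * s) = (1 - k) ^ (-(2 / 3) : ℝ) *
      (s ^ (5 / 6 - 1 : ℝ) * (1 - s) ^ (1 / 2 - 1 : ℝ) *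
        (1 - s * (1 - k)) ^ (-(1 / 3) : ℝ)) := by
  have hs' : 0 < 1 - s := sub_pos.2 hs.2
  have hm : 0 < 1 - k := sub_pos.2 hk
  rw [slitWeight, show k - (1 - (1 - k) * s) = -((1 - k) * (1 - s)) by ring, abs_neg,
    abs_of_pos (by positivity), sub_sub_cancel, Real.mul_rpow hm.le hs.1.le,
    Real.mul_rpow hm.le hs'.le,
    show (-(2 / 3) : ℝ) = -(1 / 6) + -(1 / 2) by norm_num, Real.rpow_add hm, mul_comm s (1 - k)]
  norm_num only
  ring

lemma intervalIntegrable_slitWeight_left {k : ℝ} (hk : k ∈ Ioo (0 : ℝ) 1) :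
    IntervalIntegrable (slitWeight k) MeasureTheory.volume 0 k := by
  have h : IntervalIntegrable (fun s => slitWeight k (k * s)) MeasureTheory.volume 0 1 := by
    rw [intervalIntegrable_iff_integrableOn_Ioo_of_le zero_le_one]
    refine MeasureTheory.IntegrableOn.congr_fun
      ((integrableOn_eulerIntegrand (a := 2 / 3) (b := 1 / 2) (by norm_num) (by norm_num) (1 / 6)
        hk.2).const_mul _) (fun s hs => (slitWeight_mul hk.1 hs).symm) measurableSet_Ioo
  have := h.comp_mul_left (c := k⁻¹)
  simpa [hk.1.ne'] using this

lemma integral_slitWeight_left {k : ℝ} (hk : k ∈ Ioo (0 : ℝ) 1) :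
    ∫ t in (0 : ℝ)..k, slitWeight k t =
      k ^ (1 / 6 : ℝ) * eulerIntegral (2 / 3) (1 / 2) (1 / 6) k := by
  have h := intervalIntegral.integral_comp_mul_left (a := 0) (b := 1) (slitWeight k) hk.1.ne'
  rw [mul_zero, mul_one, intervalIntegral.integral_of_le zero_le_one,
    MeasureTheory.integral_Ioc_eq_integral_Ioo,
    MeasureTheory.setIntegral_congr_fun measurableSet_Ioo (fun s hs => slitWeight_mul hk.1 hs),
    MeasureTheory.integral_const_mul, ← eulerIntegral, smul_eq_mul,
    eq_inv_mul_iff_mul_eq₀ hk.1.ne'] at h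
  rw [← h, ← mul_assoc]
  nth_rw 1 [← Real.rpow_one k]
  rw [← Real.rpow_add hk.1]
  norm_num

lemma intervalIntegrable_slitWeight_right {k : ℝ} (hk : k ∈ Ioo (0 : ℝ) 1) :
    IntervalIntegrable (slitWeight k) MeasureTheory.volume k 1 := by
  have hm : 1 - k ≠ 0 := (sub_pos.2 hk.2).ne'
  have h : IntervalIntegrable (fun s => slitWeight k (1 - (1 - k) * s))
      MeasureTheory.volume 0 1 := by
    rw [intervalIntegrable_iff_integrableOn_Ioo_of_le zero_le_one]
    refine MeasureTheory.IntegrableOn.congr_fun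
      ((integrableOn_eulerIntegrand (a := 5 / 6) (b := 1 / 2) (by norm_num) (by norm_num) (1 / 3)
        (sub_lt_self 1 hk.1)).const_mul _)
      (fun s hs => (slitWeight_one_sub_mul hk.2 hs).symm) measurableSet_Ioo
  have := ((h.comp_mul_left (c := (1 - k)⁻¹)).comp_sub_left 1).symm
  simpa [hm] using this

lemma integral_slitWeight_right {k : ℝ} (hk : k ∈ Ioo (0 : ℝ) 1) :
    ∫ t in k..1, slitWeight k t =
      (1 - k) ^ (1 / 3 : ℝ) * eulerIntegral (5 / 6) (1 / 2) (1 / 3) (1 - k) := by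
  have hm : 0 < 1 - k := sub_pos.2 hk.2
  have h := intervalIntegral.integral_comp_sub_mul (a := 0) (b := 1) (slitWeight k) hm.ne' 1
  rw [mul_zero, mul_one, sub_zero, sub_sub_cancel, intervalIntegral.integral_of_le zero_le_one,
    MeasureTheory.integral_Ioc_eq_integral_Ioo,
    MeasureTheory.setIntegral_congr_fun measurableSet_Ioo
      (fun s hs => slitWeight_one_sub_mul hk.2 hs),
    MeasureTheory.integral_const_mul, ← eulerIntegral, smul_eq_mul,
    eq_inv_mul_iff_mul_eq₀ hm.ne'] at h
  rw [← h, ← mul_assoc]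
  nth_rw 1 [← Real.rpow_one (1 - k)]
  rw [← Real.rpow_add hm]
  norm_num

lemma abs_le_norm_one_sub_mul_sq {x ε t : ℝ} (ht : t ∈ Icc (0 : ℝ) 1) :
    |1 - t * x ^ 2| ≤ ‖1 - (t : ℂ) * ((x : ℂ) - ε * I) ^ 2‖ := by
  have e : 1 - (t : ℂ) * ((x : ℂ) - ε * I) ^ 2 =
      ((1 - t * (x ^ 2 - ε ^ 2) : ℝ) : ℂ) + ((2 * t * x * ε : ℝ) : ℂ) * I := by
    push_cast
    ring_nf
    rw [I_sq]
    ring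
  rw [e, norm_add_mul_I]
  apply Real.abs_le_sqrt
  have h1 : 0 ≤ t * ε ^ 2 := mul_nonneg ht.1 (sq_nonneg _)
  have h2 : 0 ≤ t * (t * ε ^ 2) := mul_nonneg ht.1 h1
  nlinarith [sq_nonneg (t * ε ^ 2), sq_nonneg (t * x * ε)]

lemma tendsto_cpow_of_im_neg {ι : Type*} {l : Filter ι} {w : ι → ℂ} {r : ℝ} (hr : r < 0)
    (hw : Tendsto w l (nhds (r : ℂ))) (him : ∀ᶠ i in l, (w i).im < 0) :
    Tendsto (fun i => w i ^ (-(1 / 2) : ℂ)) l (nhds (((-r) ^ (-(1 / 2) : ℝ) : ℝ) * I)) := by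
  have hlog : Tendsto (fun i => Complex.log (w i)) l (nhds (Real.log ‖(r : ℂ)‖ - Real.pi * I)) :=
    (tendsto_log_nhdsWithin_im_neg_of_re_neg_of_im_zero (z := (r : ℂ)) (by simpa) (by simp)).comp
      (tendsto_nhdsWithin_iff.2 ⟨hw, him⟩)
  have h := (Complex.continuous_exp.tendsto _).comp (hlog.mul_const (-(1 / 2) : ℂ))
  have hval : Complex.exp ((Real.log ‖(r : ℂ)‖ - Real.pi * I) * (-(1 / 2) : ℂ)) =
      ((-r) ^ (-(1 / 2) : ℝ) : ℝ) * I := by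
    rw [Real.rpow_def_of_pos (neg_pos.2 hr), norm_real, Real.norm_of_nonpos hr.le, ofReal_exp,
      show ((Real.log (-r) : ℂ) - Real.pi * I) * (-(1 / 2) : ℂ) =
        ((Real.log (-r) * (-(1 / 2)) : ℝ) : ℂ) + Real.pi / 2 * I by push_cast; ring,
      Complex.exp_add, Complex.exp_pi_div_two_mul_I]
  rw [hval] at h
  refine h.congr' ?_
  filter_upwards [him] with i hi
  have : w i ≠ 0 := by
    intro h0
    simp [h0] at hi
  rw [Complex.cpow_def_of_ne_zero this]
  rfl

lemma tendsto_one_sub_mul_sq_cpow {x t : ℝ} (hx : x < -1) (ht : 0 < t) (htk : t ≠ (x ^ 2)⁻¹) :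
    Tendsto (fun ε : ℝ => (1 - (t : ℂ) * ((x : ℂ) - ε * I) ^ 2) ^ (-(1 / 2) : ℂ))
      (nhdsWithin 0 (Ioi 0)) (nhds (((|1 - t * x ^ 2| ^ (-(1 / 2) : ℝ) : ℝ) : ℂ) *
        if t ≤ (x ^ 2)⁻¹ then 1 else I)) := by
  have hx2 : 0 < x ^ 2 := by nlinarith
  have hw : Tendsto (fun ε : ℝ => 1 - (t : ℂ) * ((x : ℂ) - ε * I) ^ 2) (nhdsWithin 0 (Ioi 0))
      (nhds ((1 - t * x ^ 2 : ℝ) : ℂ)) := by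
    have : Continuous fun ε : ℝ => 1 - (t : ℂ) * ((x : ℂ) - ε * I) ^ 2 := by fun_prop
    have h := this.tendsto 0
    simp only [ofReal_zero, zero_mul, sub_zero] at h
    push_cast
    exact h.mono_left nhdsWithin_le_nhds
  split_ifs with hlt
  · have hpos : 0 < 1 - t * x ^ 2 := by
      have := lt_of_le_of_ne hlt htk
      rw [lt_inv_comm₀ ht hx2, ← one_div, lt_div_iff₀ ht] at this
      linarith
    have e : (((1 - t * x ^ 2) ^ (-(1 / 2) : ℝ) : ℝ) : ℂ) =
        ((1 - t * x ^ 2 : ℝ) : ℂ) ^ (-(1 / 2) : ℂ) := by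
      rw [ofReal_cpow hpos.le]
      norm_num
    rw [abs_of_pos hpos, mul_one, e]
    exact hw.cpow tendsto_const_nhds (ofReal_mem_slitPlane.2 hpos)
  · have hneg : 1 - t * x ^ 2 < 0 := by
      rw [not_le, inv_lt_comm₀ hx2 ht, ← one_div, div_lt_iff₀ ht] at hlt
      linarith
    rw [abs_of_neg hneg]
    refine tendsto_cpow_of_im_neg hneg hw ?_
    filter_upwards [self_mem_nhdsWithin] with ε hε
    have e : (1 - (t : ℂ) * ((x : ℂ) - ε * I) ^ 2).im = 2 * t * x * ε := by
      simp [pow_two]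
      ring
    rw [e]
    have : 0 < t * ε := mul_pos ht hε
    nlinarith

lemma abs_one_sub_mul_sq_rpow {x t : ℝ} (hx : x < -1) :
    |1 - t * x ^ 2| ^ (-(1 / 2) : ℝ) = (-x)⁻¹ * |(x ^ 2)⁻¹ - t| ^ (-(1 / 2) : ℝ) := by
  have hx0 : x ≠ 0 := by linarith
  have hx' : 0 ≤ -x := by linarith
  rw [show 1 - t * x ^ 2 = (-x) ^ 2 * ((x ^ 2)⁻¹ - t) by field_simp, abs_mul, abs_sq,
    Real.mul_rpow (sq_nonneg _) (abs_nonneg _), ← Real.rpow_natCast, ← Real.rpow_mul hx']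
  norm_num [Real.rpow_neg_one]

lemma tendsto_eulerIntegral_lower {x : ℝ} (hx : x < -1) :
    Tendsto (fun ε : ℝ => ∫ t in (0 : ℝ)..1, (t : ℂ) ^ (2 / 3 - 1 : ℂ) *
        (1 - (t : ℂ)) ^ (3 / 2 - 2 / 3 - 1 : ℂ) *
        (1 - (t : ℂ) * ((x : ℂ) - ε * I) ^ 2) ^ (-(1 / 2) : ℂ))
      (nhdsWithin 0 (Ioi 0))
      (nhds (((-x)⁻¹ : ℝ) * (((∫ t in (0 : ℝ)..(x ^ 2)⁻¹, slitWeight (x ^ 2)⁻¹ t : ℝ) : ℂ) +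
        ((∫ t in (x ^ 2)⁻¹..1, slitWeight (x ^ 2)⁻¹ t : ℝ) : ℂ) * I))) := by
  have hx2 : 1 < x ^ 2 := by nlinarith
  set k := (x ^ 2)⁻¹ with hkdef
  have hk : k ∈ Ioo (0 : ℝ) 1 := ⟨by positivity, inv_lt_one_of_one_lt₀ hx2⟩
  have hl := intervalIntegrable_slitWeight_left hk
  have hr := intervalIntegrable_slitWeight_right hk
  have hval : ∫ t in (0 : ℝ)..1, (((-x)⁻¹ * slitWeight k t : ℝ) : ℂ) *
      (if t ≤ k then 1 else I) = ((-x)⁻¹ : ℝ) *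
        (((∫ t in (0 : ℝ)..k, slitWeight k t : ℝ) : ℂ) +
          ((∫ t in k..1, slitWeight k t : ℝ) : ℂ) * I) := by
    have el : EqOn (fun t : ℝ => ((((-x)⁻¹ * slitWeight k t : ℝ) : ℂ))) (fun t : ℝ =>
        (((-x)⁻¹ * slitWeight k t : ℝ) : ℂ) * (if t ≤ k then 1 else I)) (uIoo 0 k) := by
      intro t ht
      rw [uIoo_of_le hk.1.le] at ht
      simp [ht.2.le]
    have er : EqOn (fun t : ℝ => ((((-x)⁻¹ * slitWeight k t : ℝ) : ℂ) * I)) (fun t : ℝ =>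
        (((-x)⁻¹ * slitWeight k t : ℝ) : ℂ) * (if t ≤ k then 1 else I)) (uIoo k 1) := by
      intro t ht
      rw [uIoo_of_le hk.2.le] at ht
      simp [ht.1]
    have il : IntervalIntegrable (fun t : ℝ => ((((-x)⁻¹ * slitWeight k t : ℝ) : ℂ)))
        MeasureTheory.volume 0 k := ⟨(hl.const_mul _).1.ofReal, (hl.const_mul _).2.ofReal⟩
    have ir : IntervalIntegrable (fun t : ℝ => ((((-x)⁻¹ * slitWeight k t : ℝ) : ℂ) * I))
        MeasureTheory.volume k 1 :=
      ⟨(hr.const_mul _).1.ofReal.mul_const I, (hr.const_mul _).2.ofReal.mul_const I⟩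
    rw [← intervalIntegral.integral_add_adjacent_intervals (il.congr_uIoo el) (ir.congr_uIoo er),
      ← intervalIntegral.integral_congr_uIoo el, ← intervalIntegral.integral_congr_uIoo er,
      intervalIntegral.integral_mul_const, intervalIntegral.integral_ofReal,
      intervalIntegral.integral_ofReal, intervalIntegral.integral_const_mul,
      intervalIntegral.integral_const_mul]
    push_cast
    ring
  have hfac : ∀ t ∈ Ioo (0 : ℝ) 1, (t : ℂ) ^ (2 / 3 - 1 : ℂ) *
      (1 - (t : ℂ)) ^ (3 / 2 - 2 / 3 - 1 : ℂ) =
        ((t ^ (-(1 / 3) : ℝ) * (1 - t) ^ (-(1 / 6) : ℝ) : ℝ) : ℂ) := by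
    intro t ht
    rw [ofReal_mul, ofReal_cpow ht.1.le, ofReal_cpow (sub_nonneg.2 ht.2.le)]
    norm_num
  have hae : ∀ᵐ t : ℝ, t ≠ k ∧ t ≠ 1 := by
    filter_upwards [MeasureTheory.Measure.ae_ne MeasureTheory.volume k,
      MeasureTheory.Measure.ae_ne MeasureTheory.volume 1] with t h1 h2 using ⟨h1, h2⟩
  rw [← hval]
  refine intervalIntegral.tendsto_integral_filter_of_dominated_convergence
    (fun t => (-x)⁻¹ * slitWeight k t) ?_ ?_ ((hl.trans hr).const_mul _) ?_
  · refine Eventually.of_forall fun ε => Measurable.aestronglyMeasurable ?_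
    fun_prop
  · refine Eventually.of_forall fun ε => ?_
    filter_upwards [hae] with t hne ht
    rw [uIoc_of_le zero_le_one] at ht
    have ht' : t ∈ Ioo (0 : ℝ) 1 := ⟨ht.1, lt_of_le_of_ne ht.2 hne.2⟩
    have ht0 := ht'.1
    have ht1 : 0 < 1 - t := sub_pos.2 ht'.2
    have hne' : 1 - t * x ^ 2 ≠ 0 := by
      intro h
      exact hne.1 (eq_inv_of_mul_eq_one_left (by linarith))
    have hpow : ‖(1 - (t : ℂ) * ((x : ℂ) - ε * I) ^ 2) ^ (-(1 / 2) : ℂ)‖ ≤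
        (-x)⁻¹ * |k - t| ^ (-(1 / 2) : ℝ) := by
      rw [hkdef, ← abs_one_sub_mul_sq_rpow hx,
        show (-(1 / 2) : ℂ) = ((-(1 / 2) : ℝ) : ℂ) by norm_num, norm_cpow_real]
      exact Real.rpow_le_rpow_of_nonpos (abs_pos.2 hne')
        (abs_le_norm_one_sub_mul_sq (Ioo_subset_Icc_self ht')) (by norm_num)
    rw [hfac t ht', norm_mul, norm_real, Real.norm_of_nonneg (by positivity)]
    calc _ ≤ t ^ (-(1 / 3) : ℝ) * (1 - t) ^ (-(1 / 6) : ℝ) *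
          ((-x)⁻¹ * |k - t| ^ (-(1 / 2) : ℝ)) := by gcongr
      _ = _ := by
        rw [slitWeight]
        ring
  · filter_upwards [hae] with t hne ht
    rw [uIoc_of_le zero_le_one] at ht
    have ht' : t ∈ Ioo (0 : ℝ) 1 := ⟨ht.1, lt_of_le_of_ne ht.2 hne.2⟩
    have h := (tendsto_one_sub_mul_sq_cpow hx ht'.1 hne.1).const_mul
      ((t ^ (-(1 / 3) : ℝ) * (1 - t) ^ (-(1 / 6) : ℝ) : ℝ) : ℂ)
    rw [hfac t ht']
    convert h using 2
    rw [abs_one_sub_mul_sq_rpow hx, slitWeight]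
    push_cast
    ring

lemma g_prefactor :
    2 * (√3 : ℂ) * Complex.Gamma (2 / 3) / ((√Real.pi : ℂ) * Complex.Gamma (1 / 6)) *
      (Complex.Gamma (3 / 2) / (Complex.Gamma (2 / 3) * Complex.Gamma (3 / 2 - 2 / 3))) =
    ((√3 / (2 * Real.pi) : ℝ) : ℂ) := by
  have h1 : Complex.Gamma (3 / 2) = 1 / 2 * (√Real.pi : ℂ) := by
    have h := Complex.Gamma_add_one (1 / 2) (by norm_num)
    rw [show (1 / 2 + 1 : ℂ) = 3 / 2 by norm_num] at h
    rw [h, show (1 / 2 : ℂ) = ((1 / 2 : ℝ) : ℂ) by norm_num, Complex.Gamma_ofReal,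
      Real.Gamma_one_half_eq]
  have h2 : Complex.Gamma (1 / 6) * Complex.Gamma (5 / 6) = 2 * Real.pi := by
    have h3 := Real.Gamma_mul_Gamma_one_sub (1 / 6)
    rw [show Real.pi * (1 / 6) = Real.pi / 6 by ring, Real.sin_pi_div_six] at h3
    rw [show (1 / 6 : ℂ) = ((1 / 6 : ℝ) : ℂ) by norm_num,
      show (5 / 6 : ℂ) = ((1 - 1 / 6 : ℝ) : ℂ) by norm_num, Complex.Gamma_ofReal,
      Complex.Gamma_ofReal, ← ofReal_mul, h3]
    push_cast
    ring
  have h4 : Complex.Gamma (2 / 3) ≠ 0 := Complex.Gamma_ne_zero_of_re_pos (by norm_num)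
  have h5 : (√Real.pi : ℂ) ≠ 0 := ofReal_ne_zero.2 (Real.sqrt_pos.2 Real.pi_pos).ne'
  have h6 : (Real.pi : ℂ) ≠ 0 := ofReal_ne_zero.2 Real.pi_ne_zero
  have h7 : Complex.Gamma (1 / 6) ≠ 0 := fun h => by
    rw [h] at h2
    simp [h6] at h2
  have h8 : Complex.Gamma (5 / 6) ≠ 0 := fun h => by
    rw [h] at h2
    simp [h6] at h2
  rw [h1, show (3 / 2 - 2 / 3 : ℂ) = 5 / 6 by norm_num]
  push_cast
  rw [← h2]
  field_simp

lemma tendsto_g_lower {x : ℝ} (hx : x < -1) :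
    Tendsto (fun ε : ℝ => g ((x : ℂ) - ε * I)) (nhdsWithin 0 (Ioi 0))
      (nhds (-((√3 / (2 * Real.pi) : ℝ) *
        (((∫ t in (0 : ℝ)..(x ^ 2)⁻¹, slitWeight (x ^ 2)⁻¹ t : ℝ) : ℂ) +
          ((∫ t in (x ^ 2)⁻¹..1, slitWeight (x ^ 2)⁻¹ t : ℝ) : ℂ) * I)))) := by
  have hz : Tendsto (fun ε : ℝ => (x : ℂ) - ε * I) (nhdsWithin 0 (Ioi 0)) (nhds (x : ℂ)) := by
    have : Continuous fun ε : ℝ => (x : ℂ) - ε * I := by fun_prop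
    have h := this.tendsto 0
    simp only [ofReal_zero, zero_mul, sub_zero] at h
    exact h.mono_left nhdsWithin_le_nhds
  have hx0 : (x : ℂ) ≠ 0 := ofReal_ne_zero.2 (by linarith)
  convert (hz.mul (tendsto_eulerIntegral_lower hx)).const_mul
    ((√3 / (2 * Real.pi) : ℝ) : ℂ) using 1
  · funext ε
    rw [← g_prefactor, g, hyp]
    ring
  · congr 1
    push_cast
    field_simp

theorem stmt_12 (u v : ℝ) (hu : 0 < u) (huv : u < v) :
    ((u + v) / (u - v) : ℝ) < -1 ∧
    ∃ L : ℂ,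
      Filter.Tendsto
        (fun ε : ℝ => g ((((u + v) / (u - v) : ℝ) : ℂ) - ε * Complex.I))
        (nhdsWithin 0 (Set.Ioi 0)) (nhds L) ∧
      L ∈ segment ℝ (-1 : ℂ) (-(Complex.I * Real.sqrt 3)) := by
  have hx : ((u + v) / (u - v) : ℝ) < -1 := by
    rw [div_lt_iff_of_neg (sub_neg.2 huv)]
    linarith
  refine ⟨hx, _, tendsto_g_lower hx, ?_⟩
  set x : ℝ := (u + v) / (u - v)
  have hx2 : 1 < x ^ 2 := by nlinarith
  have hk : (x ^ 2)⁻¹ ∈ Ioo (0 : ℝ) 1 := ⟨by positivity, inv_lt_one_of_one_lt₀ hx2⟩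
  have key := sqrt_three_mul_eulerIntegral_add hk
  rw [← integral_slitWeight_left hk, ← integral_slitWeight_right hk] at key
  have hP : 0 ≤ ∫ t in (0 : ℝ)..(x ^ 2)⁻¹, slitWeight (x ^ 2)⁻¹ t :=
    intervalIntegral.integral_nonneg hk.1.le fun t ht =>
      slitWeight_nonneg ⟨ht.1, ht.2.trans hk.2.le⟩
  have hQ : 0 ≤ ∫ t in (x ^ 2)⁻¹..1, slitWeight (x ^ 2)⁻¹ t :=
    intervalIntegral.integral_nonneg hk.2.le fun t ht =>
      slitWeight_nonneg ⟨hk.1.le.trans ht.1, ht.2⟩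
  generalize (∫ t in (0 : ℝ)..(x ^ 2)⁻¹, slitWeight (x ^ 2)⁻¹ t) = P at *
  generalize (∫ t in (x ^ 2)⁻¹..1, slitWeight (x ^ 2)⁻¹ t) = Q at *
  have hpi := Real.pi_pos
  have s3 : √3 * √3 = 3 := Real.mul_self_sqrt (by norm_num)
  refine ⟨√3 * P / (2 * Real.pi), Q / (2 * Real.pi), by positivity, by positivity, ?_, ?_⟩
  · rw [← add_div, key, div_self (by positivity)]
  · simp only [real_smul]
    push_cast
    ring
end
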